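/- arXiv:1409.2711 — 7 statements merged into one kernel-verified Lean document; each statement's English description precedes it below -/
import Mathlib

section
/- HyperLTL is not subsumed by KCTL* over finite Kripke structures: there exists a HyperLTL sentence φ (one may take φ := ∃x.∃y.( p[x] U ( (p[x]∧¬p[y]) ∧ XG(p[x]↔p[y]) ) )) such that for every observation map Obs and every KCTL* sentence ψ there is a finite Kripke structure K with ( K ⊨ φ ) not equivalent to ( (K,Obs) ⊨ ψ ). -/
/-- A Kripke structure over a set `AP` of atomic propositions. -/
structure Kripke (AP : Type) where
  S : Type
  s0 : S
  E : S → S → Prop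
  total : ∀ s, ∃ t, E s t
  V : S → Set AP

/-- `pa` is an initial path of the Kripke structure `K`. -/
def Kripke.IsInit {AP : Type} (K : Kripke AP) (pa : ℕ → K.S) : Prop :=
  pa 0 = K.s0 ∧ ∀ i, K.E (pa i) (pa (i + 1))
/-- Syntax of KCTL* over atomic propositions `AP` and agents `Agt`. -/
inductive KCTLs (AP Agt : Type) where
  | tt : KCTLs AP Agt
  | atom : AP → KCTLs AP Agt
  | neg : KCTLs AP Agt → KCTLs AP Agt
  | disj : KCTLs AP Agt → KCTLs AP Agt → KCTLs AP Agt
  | next : KCTLs AP Agt → KCTLs AP Agt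
  | untl : KCTLs AP Agt → KCTLs AP Agt → KCTLs AP Agt
  | ex : KCTLs AP Agt → KCTLs AP Agt
  | know : Agt → KCTLs AP Agt → KCTLs AP Agt

/-- A KCTL* sentence: every temporal/knowledge modality is in the scope of a path
quantifier. -/
def KCTLs.isSentence {AP Agt : Type} : KCTLs AP Agt → Prop
  | .tt => True
  | .atom _ => True
  | .neg φ => φ.isSentence
  | .disj φ ψ => φ.isSentence ∧ ψ.isSentence
  | .next _ => False
  | .untl _ _ => False
  | .know _ _ => False
  | .ex _ => True

/-- No path quantifiers occur in the formula. -/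
def KCTLs.quantFree {AP Agt : Type} : KCTLs AP Agt → Prop
  | .tt => True
  | .atom _ => True
  | .neg φ => φ.quantFree
  | .disj φ ψ => φ.quantFree ∧ ψ.quantFree
  | .next φ => φ.quantFree
  | .untl φ ψ => φ.quantFree ∧ ψ.quantFree
  | .ex _ => False
  | .know _ φ => φ.quantFree

/-- A KLTL sentence: of the form `∀ φ = ¬∃¬φ` with `φ` free of path quantifiers. -/
def KCTLs.isKLTL {AP Agt : Type} : KCTLs AP Agt → Prop
  | .neg (.ex (.neg φ)) => φ.quantFree
  | _ => False

/-- Size of a KCTL* formula. -/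
def KCTLs.size {AP Agt : Type} : KCTLs AP Agt → ℕ
  | .tt => 1
  | .atom _ => 1
  | .neg φ => φ.size + 1
  | .disj φ ψ => φ.size + ψ.size + 1
  | .next φ => φ.size + 1
  | .untl φ ψ => φ.size + ψ.size + 1
  | .ex φ => φ.size + 1
  | .know _ φ => φ.size + 1

/-- A KCTL* formula is balanced if for every until subformula `φ U ψ`, `|φ| = |ψ|`. -/
def KCTLs.balanced {AP Agt : Type} : KCTLs AP Agt → Prop
  | .tt => True
  | .atom _ => True
  | .neg φ => φ.balanced
  | .disj φ ψ => φ.balanced ∧ ψ.balanced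
  | .next φ => φ.balanced
  | .untl φ ψ => φ.size = ψ.size ∧ φ.balanced ∧ ψ.balanced
  | .ex φ => φ.balanced
  | .know _ φ => φ.balanced
/-- Satisfaction of KCTL* over an extended Kripke structure `(K, Obs)`, with synchronous
perfect recall semantics for the knowledge modalities. -/
def KCTLs.sat {AP Agt : Type} (K : Kripke AP) (Obs : Agt → Set AP) :
    KCTLs AP Agt → (ℕ → K.S) → ℕ → Prop
  | .tt, _, _ => True
  | .atom p, pa, i => p ∈ K.V (pa i)
  | .neg φ, pa, i => ¬ KCTLs.sat K Obs φ pa i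
  | .disj φ ψ, pa, i => KCTLs.sat K Obs φ pa i ∨ KCTLs.sat K Obs ψ pa i
  | .next φ, pa, i => KCTLs.sat K Obs φ pa (i + 1)
  | .untl φ ψ, pa, i => ∃ j, i ≤ j ∧ KCTLs.sat K Obs ψ pa j ∧
      ∀ k, i ≤ k → k < j → KCTLs.sat K Obs φ pa k
  | .ex φ, pa, i => ∃ pa', K.IsInit pa' ∧ (∀ j, j ≤ i → pa' j = pa j) ∧
      KCTLs.sat K Obs φ pa' i
  | .know a φ, pa, i => ∀ pa', K.IsInit pa' →
      (∀ j, j ≤ i → ∀ q ∈ Obs a, (q ∈ K.V (pa j) ↔ q ∈ K.V (pa' j))) →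
      KCTLs.sat K Obs φ pa' i

/-- `(K, Obs) ⊨ φ` : some initial path satisfies `φ` at position `0`. -/
def KCTLs.models {AP Agt : Type} (K : Kripke AP) (Obs : Agt → Set AP)
    (φ : KCTLs AP Agt) : Prop :=
  ∃ pa, K.IsInit pa ∧ KCTLs.sat K Obs φ pa 0
/-- Syntax of HyperCTL* over atomic propositions `AP` and path variables `Var`. -/
inductive HCTLs (AP Var : Type) where
  | tt : HCTLs AP Var
  | atom : AP → Var → HCTLs AP Var
  | neg : HCTLs AP Var → HCTLs AP Var
  | conj : HCTLs AP Var → HCTLs AP Var → HCTLs AP Var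
  | next : HCTLs AP Var → HCTLs AP Var
  | untl : HCTLs AP Var → HCTLs AP Var → HCTLs AP Var
  | ex : Var → HCTLs AP Var → HCTLs AP Var

/-- All atoms `p[x]` use variables from `B` (bound variables), recursively. -/
def HCTLs.closedIn {AP Var : Type} : HCTLs AP Var → Set Var → Prop
  | .tt, _ => True
  | .atom _ x, B => x ∈ B
  | .neg φ, B => φ.closedIn B
  | .conj φ ψ, B => φ.closedIn B ∧ ψ.closedIn B
  | .next φ, B => φ.closedIn B
  | .untl φ ψ, B => φ.closedIn B ∧ ψ.closedIn B
  | .ex x φ, B => φ.closedIn (insert x B)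

/-- A HyperCTL* sentence: every temporal modality is in the scope of a path quantifier
and every atom `p[x]` has `x` bound by a path quantifier. -/
def HCTLs.isSentence {AP Var : Type} : HCTLs AP Var → Prop
  | .tt => True
  | .atom _ _ => False
  | .neg φ => φ.isSentence
  | .conj φ ψ => φ.isSentence ∧ ψ.isSentence
  | .next _ => False
  | .untl _ _ => False
  | .ex x φ => φ.closedIn {x}

/-- No path quantifiers occur in the formula. -/
def HCTLs.quantFree {AP Var : Type} : HCTLs AP Var → Prop
  | .tt => True
  | .atom _ _ => True
  | .neg φ => φ.quantFree
  | .conj φ ψ => φ.quantFree ∧ ψ.quantFree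
  | .next φ => φ.quantFree
  | .untl φ ψ => φ.quantFree ∧ ψ.quantFree
  | .ex _ _ => False

/-- Prenex form: a block of path quantifiers (existential, or universal encoded as
`¬∃¬`) followed by a quantifier-free formula. -/
inductive HCTLs.prenex {AP Var : Type} : HCTLs AP Var → Prop
  | qf {φ : HCTLs AP Var} : φ.quantFree → φ.prenex
  | exq {x : Var} {φ : HCTLs AP Var} : φ.prenex → (HCTLs.ex x φ).prenex
  | allq {x : Var} {φ : HCTLs AP Var} :
      φ.prenex → (HCTLs.neg (HCTLs.ex x (HCTLs.neg φ))).prenex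

/-- A HyperLTL sentence: a HyperCTL* sentence in prenex form. -/
def HCTLs.isHyperLTL {AP Var : Type} (φ : HCTLs AP Var) : Prop :=
  φ.prenex ∧ φ.isSentence

/-- Size of a HyperCTL* formula. -/
def HCTLs.size {AP Var : Type} : HCTLs AP Var → ℕ
  | .tt => 1
  | .atom _ _ => 1
  | .neg φ => φ.size + 1
  | .conj φ ψ => φ.size + ψ.size + 1
  | .next φ => φ.size + 1
  | .untl φ ψ => φ.size + ψ.size + 1
  | .ex _ φ => φ.size + 1
/-- Satisfaction of HyperCTL* over a Kripke structure `K`, w.r.t. a path assignment,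
a current path variable and a position. -/
def HCTLs.sat {AP Var : Type} [DecidableEq Var] (K : Kripke AP) :
    HCTLs AP Var → (Var → (ℕ → K.S)) → Var → ℕ → Prop
  | .tt, _, _, _ => True
  | .atom p x, A, _, i => p ∈ K.V (A x i)
  | .neg φ, A, y, i => ¬ HCTLs.sat K φ A y i
  | .conj φ ψ, A, y, i => HCTLs.sat K φ A y i ∧ HCTLs.sat K ψ A y i
  | .next φ, A, y, i => HCTLs.sat K φ A y (i + 1)
  | .untl φ ψ, A, y, i => ∃ j, i ≤ j ∧ HCTLs.sat K ψ A y j ∧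
      ∀ k, i ≤ k → k < j → HCTLs.sat K φ A y k
  | .ex x φ, A, y, i => ∃ pa, K.IsInit pa ∧ (∀ j, j ≤ i → pa j = A y j) ∧
      HCTLs.sat K φ (Function.update A x pa) x i

/-- `K ⊨ φ` : there are a path assignment (into initial paths) and a variable `y`
such that `φ` holds at position 0. -/
def HCTLs.models {AP Var : Type} [DecidableEq Var] (K : Kripke AP)
    (φ : HCTLs AP Var) : Prop :=
  ∃ (A : Var → (ℕ → K.S)) (y : Var), (∀ x, K.IsInit (A x)) ∧ HCTLs.sat K φ A y 0

namespace BranchingTraces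

/-- States of the structure whose paths branch at the root and then follow a fixed word. -/
abbrev State (n : ℕ) : Type := Option ((Fin (n + 1) → Bool) × Fin (n + 2))

/-- The Kripke structure branching at its root to one word for each element of `T`; letters
are read as truth values of `p`, and every word ends in a sink where `p` is false. -/
def structOf {AP : Type} (p : AP) {n : ℕ} (T : Set (Fin (n + 1) → Bool)) (hT : T.Nonempty) :
    Kripke AP where
  S := State n
  s0 := none
  E s t := match s with
    | none => ∃ x ∈ T, t = some (x, 0)
    | some (x, k) => t = some (x, ⟨min (k.1 + 1) (n + 1), by omega⟩)
  total s := match s with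
    | none => ⟨_, hT.choose, hT.choose_spec, rfl⟩
    | some (_, _) => ⟨_, rfl⟩
  V s := match s with
    | none => ∅
    | some (x, k) => {q | q = p ∧ ∃ h : k.1 < n + 1, x ⟨k.1, h⟩ = true}

/-- The path from the root along the word `x`. -/
def path {n : ℕ} (x : Fin (n + 1) → Bool) : ℕ → State n
  | 0 => none
  | k + 1 => some (x, ⟨min k (n + 1), by omega⟩)

/-- The truth value of `p` along `path x`. -/
def bit {n : ℕ} (x : Fin (n + 1) → Bool) : ℕ → Prop
  | 0 => False
  | k + 1 => ∃ h : k < n + 1, x ⟨k, h⟩ = true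

variable {AP Agt : Type} {p : AP} {n : ℕ}

theorem mem_V_path {T : Set (Fin (n + 1) → Bool)} {hT : T.Nonempty} (x : Fin (n + 1) → Bool)
    (i : ℕ) (q : AP) : q ∈ (structOf p T hT).V (path x i) ↔ q = p ∧ bit x i := by
  cases i with
  | zero => simp [structOf, path, bit]
  | succ k =>
    by_cases hk : k < n + 1
    · have : min k (n + 1) = k := by omega
      simp [structOf, path, bit, this]
    · have : min k (n + 1) = n + 1 := by omega
      simp [structOf, path, bit, this, hk]

theorem isInit_iff {T : Set (Fin (n + 1) → Bool)} {hT : T.Nonempty} (pa : ℕ → State n) :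
    (structOf p T hT).IsInit pa ↔ ∃ x ∈ T, pa = path x := by
  constructor
  · rintro ⟨h0, hE⟩
    have h1 := hE 0
    rw [h0] at h1
    obtain ⟨x, hx, h1⟩ := h1
    refine ⟨x, hx, funext fun i => ?_⟩
    cases i with
    | zero => exact h0
    | succ k =>
      induction k with
      | zero => simpa [path] using h1
      | succ k ih =>
        have h := hE (k + 1)
        rw [ih] at h
        refine Eq.trans h ?_
        simp only [path]
        congr 3
        omega
  · rintro ⟨x, hx, rfl⟩
    refine ⟨rfl, fun i => ?_⟩
    cases i with
    | zero => exact ⟨x, hx, by simp [path]⟩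
    | succ k =>
      change path x (k + 1 + 1) = some (x, _)
      simp only [path]
      congr 3
      omega

theorem path_eq_of_le {x y : Fin (n + 1) → Bool} {i j : ℕ} (hi : 1 ≤ i)
    (h : ∀ j, j ≤ i → path y j = path x j) : path y j = path x j := by
  have := h 1 hi
  simp only [path, Option.some.injEq, Prod.mk.injEq] at this
  rw [this.1]

theorem path_const (x : Fin (n + 1) → Bool) {i : ℕ} (hi : n + 2 ≤ i) :
    path x i = path x (n + 2) := by
  obtain ⟨k, rfl⟩ : ∃ k, i = k + 1 := ⟨i - 1, by omega⟩
  have : min k (n + 1) = n + 1 := by omega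
  simp [path, this]

/-- Agent `a` cannot distinguish `x` and `y` up to time `i`. -/
def Indist (Obs : Agt → Set AP) (p : AP) (a : Agt) (i : ℕ) (x y : Fin (n + 1) → Bool) : Prop :=
  p ∈ Obs a → ∀ j, j ≤ i → (bit x j ↔ bit y j)

theorem Indist.of_sink {Obs : Agt → Set AP} {a : Agt} {i : ℕ} {x y : Fin (n + 1) → Bool}
    (h : Indist Obs p a (n + 2) x y) : Indist Obs p a i x y := by
  intro hp j _
  by_cases hj' : j ≤ n + 2
  · exact h hp j hj'
  · obtain ⟨k, rfl⟩ : ∃ k, j = k + 1 := ⟨j - 1, by omega⟩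
    have : ¬ k < n + 1 := by omega
    simp [bit, this]

theorem Indist.mono {Obs : Agt → Set AP} {a : Agt} {i j : ℕ} {x y : Fin (n + 1) → Bool}
    (h : Indist Obs p a i x y) (hij : j ≤ i) : Indist Obs p a j x y :=
  fun hp k hk => h hp k (hk.trans hij)

theorem Indist.zero_eq {Obs : Agt → Set AP} {a : Agt} {i : ℕ} {x y : Fin (n + 1) → Bool}
    (h : Indist Obs p a i x y) (hp : p ∈ Obs a) (hi : 1 ≤ i) : y 0 = x 0 := by
  have := h hp 1 hi
  simp only [bit, Nat.zero_lt_succ, exists_true_left, Fin.mk_zero] at this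
  exact (Bool.eq_iff_iff.2 this).symm

section Sat

variable {Obs : Agt → Set AP} {T : Set (Fin (n + 1) → Bool)} {hT : T.Nonempty}

theorem models_iff {φ : KCTLs AP Agt} : KCTLs.models (structOf p T hT) Obs φ ↔
    ∃ x ∈ T, KCTLs.sat (structOf p T hT) Obs φ (path x) 0 := by
  constructor
  · rintro ⟨pa, hpa, h⟩
    obtain ⟨x, hx, rfl⟩ := (isInit_iff _).1 hpa
    exact ⟨x, hx, h⟩
  · rintro ⟨x, hx, h⟩
    exact ⟨path x, (isInit_iff _).2 ⟨x, hx, rfl⟩, h⟩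

theorem sat_ex_iff {φ : KCTLs AP Agt} {x : Fin (n + 1) → Bool} {i : ℕ} :
    KCTLs.sat (structOf p T hT) Obs (.ex φ) (path x) i ↔
      ∃ y ∈ T, (∀ j, j ≤ i → path y j = path x j) ∧
        KCTLs.sat (structOf p T hT) Obs φ (path y) i := by
  constructor
  · rintro ⟨pa, hpa, h⟩
    obtain ⟨y, hy, rfl⟩ := (isInit_iff _).1 hpa
    exact ⟨y, hy, h⟩
  · rintro ⟨y, hy, h⟩
    exact ⟨path y, (isInit_iff _).2 ⟨y, hy, rfl⟩, h⟩

theorem sat_know_iff {φ : KCTLs AP Agt} {a : Agt} {x : Fin (n + 1) → Bool} {i : ℕ} :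
    KCTLs.sat (structOf p T hT) Obs (.know a φ) (path x) i ↔
      ¬ ∃ y ∈ T, Indist Obs p a i x y ∧
        KCTLs.sat (structOf p T hT) Obs (.neg φ) (path y) i := by
  have key : ∀ y : Fin (n + 1) → Bool,
      (∀ j, j ≤ i → ∀ q ∈ Obs a, (q ∈ (structOf p T hT).V (path x j) ↔
        q ∈ (structOf p T hT).V (path y j))) ↔ Indist Obs p a i x y := by
    intro y
    simp only [mem_V_path]
    constructor
    · intro h hp j hj
      simpa using h j hj p hp
    · intro h j hj q hq
      refine and_congr_right ?_
      rintro rfl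
      exact h hq j hj
  constructor
  · rintro h ⟨y, hy, hxy, hn⟩
    exact hn (h (path y) ((isInit_iff _).2 ⟨y, hy, rfl⟩) ((key y).2 hxy))
  · intro h pa hpa hxy
    obtain ⟨y, hy, rfl⟩ := (isInit_iff _).1 hpa
    by_contra hn
    exact h ⟨y, hy, (key y).1 hxy, hn⟩

/-- Satisfaction no longer changes once the paths have reached their sinks. -/
theorem sat_const (χ : KCTLs AP Agt) : ∀ (x : Fin (n + 1) → Bool) {i : ℕ}, n + 2 ≤ i →
    (KCTLs.sat (structOf p T hT) Obs χ (path x) i ↔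
      KCTLs.sat (structOf p T hT) Obs χ (path x) (n + 2)) := by
  induction χ with
  | tt => intros; rfl
  | atom q =>
    intro x i hi
    simp only [KCTLs.sat]
    rw [path_const x hi]
  | neg φ ih => intro x i hi; exact not_congr (ih x hi)
  | disj φ ψ ih₁ ih₂ => intro x i hi; exact or_congr (ih₁ x hi) (ih₂ x hi)
  | next φ ih =>
    intro x i hi
    exact (ih x (by omega : n + 2 ≤ i + 1)).trans (ih x (by omega : n + 2 ≤ n + 2 + 1)).symm
  | untl φ ψ ih₁ ih₂ =>
    have key : ∀ x : Fin (n + 1) → Bool, ∀ i, n + 2 ≤ i →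
        (KCTLs.sat (structOf p T hT) Obs (.untl φ ψ) (path x) i ↔
          KCTLs.sat (structOf p T hT) Obs ψ (path x) (n + 2)) := by
      intro x i hi
      constructor
      · rintro ⟨j, hj, h, -⟩
        exact (ih₂ x (hi.trans hj)).1 h
      · intro h
        exact ⟨i, le_rfl, (ih₂ x hi).2 h, fun k h₁ h₂ => absurd h₂ (by omega)⟩
    intro x i hi
    exact (key x i hi).trans (key x _ le_rfl).symm
  | ex φ ih =>
    intro x i hi
    rw [sat_ex_iff, sat_ex_iff]
    refine exists_congr fun y => and_congr_right fun _ => and_congr ?_ (ih y hi)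
    constructor <;> intro h j _ <;> exact path_eq_of_le (by omega) h
  | know a φ ih =>
    intro x i hi
    rw [sat_know_iff, sat_know_iff]
    refine not_congr (exists_congr fun y => and_congr_right fun _ => and_congr ?_
      (not_congr (ih y hi)))
    exact ⟨fun h => h.mono hi, fun h => h.of_sink⟩

end Sat

/-- Some word of `T` with first letter `b` satisfies `χ` at time `i`. -/
def Realized (Obs : Agt → Set AP) (p : AP) (T : Set (Fin (n + 1) → Bool)) (hT : T.Nonempty)
    (χ : KCTLs AP Agt) (b : Bool) (i : ℕ) : Prop :=
  ∃ x ∈ T, x 0 = b ∧ KCTLs.sat (structOf p T hT) Obs χ (path x) i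

theorem realized_const {Obs : Agt → Set AP} {T : Set (Fin (n + 1) → Bool)} {hT : T.Nonempty}
    {χ : KCTLs AP Agt} {b : Bool} {i : ℕ} (hi : n + 2 ≤ i) :
    Realized Obs p T hT χ b i ↔ Realized Obs p T hT χ b (n + 2) :=
  exists_congr fun x => and_congr_right fun _ => and_congr_right fun _ => sat_const χ x hi

/-- The formulas whose realizability in a structure the evaluation of a formula refers to. -/
def quantified : KCTLs AP Agt → List (KCTLs AP Agt)
  | .tt => []
  | .atom _ => []
  | .neg φ => quantified φ
  | .disj φ ψ => quantified φ ++ quantified ψ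
  | .next φ => quantified φ
  | .untl φ ψ => quantified φ ++ quantified ψ
  | .ex φ => φ :: quantified φ
  | .know _ φ => .neg φ :: quantified φ

/-- The words that belong to the member of the family `T` selected by their first letter. -/
def glue (T : Bool → Set (Fin (n + 1) → Bool)) : Set (Fin (n + 1) → Bool) :=
  {x | x ∈ T (x 0)}

section Glue

variable {Obs : Agt → Set AP} {T : Bool → Set (Fin (n + 1) → Bool)} {hT : ∀ b, (T b).Nonempty}
  {hG : (glue T).Nonempty}

theorem exists_glue_iff {χ : KCTLs AP Agt} {i : ℕ}
    (hχ : ∀ b c c', Realized Obs p (T c) (hT c) χ b i ↔ Realized Obs p (T c') (hT c') χ b i)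
    (ih : ∀ x ∈ glue T, (KCTLs.sat (structOf p (glue T) hG) Obs χ (path x) i ↔
      KCTLs.sat (structOf p (T (x 0)) (hT (x 0))) Obs χ (path x) i))
    (c : Bool) :
    (∃ y ∈ glue T, KCTLs.sat (structOf p (glue T) hG) Obs χ (path y) i) ↔
      ∃ y ∈ T c, KCTLs.sat (structOf p (T c) (hT c)) Obs χ (path y) i := by
  constructor
  · rintro ⟨y, hy, h⟩
    obtain ⟨z, hz, -, h'⟩ := (hχ (y 0) (y 0) c).1 ⟨y, hy, rfl, (ih y hy).1 h⟩
    exact ⟨z, hz, h'⟩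
  · rintro ⟨y, hy, h⟩
    obtain ⟨b, hb⟩ : ∃ b, y 0 = b := ⟨_, rfl⟩
    obtain ⟨z, hz, rfl, h'⟩ := (hχ b c b).1 ⟨y, hy, hb, h⟩
    exact ⟨z, hz, (ih z hz).2 h'⟩

theorem exists_glue_rel_iff {χ : KCTLs AP Agt} {i : ℕ}
    (hχ : ∀ b c c', Realized Obs p (T c) (hT c) χ b i ↔ Realized Obs p (T c') (hT c') χ b i)
    (ih : ∀ x ∈ glue T, (KCTLs.sat (structOf p (glue T) hG) Obs χ (path x) i ↔
      KCTLs.sat (structOf p (T (x 0)) (hT (x 0))) Obs χ (path x) i))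
    {R : (Fin (n + 1) → Bool) → Prop} {c : Bool} (hR : (∀ y, R y) ∨ ∀ y, R y → y 0 = c) :
    (∃ y ∈ glue T, R y ∧ KCTLs.sat (structOf p (glue T) hG) Obs χ (path y) i) ↔
      ∃ y ∈ T c, R y ∧ KCTLs.sat (structOf p (T c) (hT c)) Obs χ (path y) i := by
  rcases hR with hR | hR
  · simpa only [hR, true_and] using exists_glue_iff hχ ih c
  · constructor
    · rintro ⟨y, hy, hRy, h⟩
      have h' := (ih y hy).1 h
      obtain rfl := hR y hRy
      exact ⟨y, hy, hRy, h'⟩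
    · rintro ⟨y, hy, hRy, h⟩
      obtain rfl := hR y hRy
      exact ⟨y, hy, hRy, (ih y hy).2 h⟩

/-- If the members of `T` realize the same quantified formulas, then gluing them does not
affect satisfaction. -/
theorem sat_glue_iff (χ : KCTLs AP Agt)
    (hχ : ∀ ξ ∈ quantified χ, ∀ i b c c',
      Realized Obs p (T c) (hT c) ξ b i ↔ Realized Obs p (T c') (hT c') ξ b i) :
    ∀ (i : ℕ), ∀ x ∈ glue T, (KCTLs.sat (structOf p (glue T) hG) Obs χ (path x) i ↔
      KCTLs.sat (structOf p (T (x 0)) (hT (x 0))) Obs χ (path x) i) := by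
  induction χ with
  | tt => intros; rfl
  | atom q => intros; rfl
  | neg φ ih => intro i x hx; exact not_congr (ih hχ i x hx)
  | disj φ ψ ih₁ ih₂ =>
    intro i x hx
    exact or_congr (ih₁ (fun ξ hξ => hχ ξ (List.mem_append_left _ hξ)) i x hx)
      (ih₂ (fun ξ hξ => hχ ξ (List.mem_append_right _ hξ)) i x hx)
  | next φ ih => intro i x hx; exact ih hχ (i + 1) x hx
  | untl φ ψ ih₁ ih₂ =>
    intro i x hx
    have h₁ := fun k => ih₁ (fun ξ hξ => hχ ξ (List.mem_append_left _ hξ)) k x hx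
    have h₂ := fun k => ih₂ (fun ξ hξ => hχ ξ (List.mem_append_right _ hξ)) k x hx
    simp only [KCTLs.sat, h₁, h₂]
  | ex φ ih =>
    intro i x _
    rw [sat_ex_iff, sat_ex_iff]
    refine exists_glue_rel_iff (hχ φ (List.mem_cons_self ..) i)
      (ih (fun ξ hξ => hχ ξ (List.mem_cons_of_mem _ hξ)) i) ?_
    rcases Nat.eq_zero_or_pos i with rfl | hi
    · left
      intro y j hj
      obtain rfl := Nat.le_zero.1 hj
      rfl
    · right
      intro y hy
      have := hy 1 hi
      simp only [path, Option.some.injEq, Prod.mk.injEq] at this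
      rw [this.1]
  | know a φ ih =>
    intro i x _
    rw [sat_know_iff, sat_know_iff]
    refine not_congr (exists_glue_rel_iff (hχ (.neg φ) (List.mem_cons_self ..) i)
      (fun y hy => not_congr (ih (fun ξ hξ => hχ ξ (List.mem_cons_of_mem _ hξ)) i y hy)) ?_)
    by_cases hp : p ∈ Obs a
    · rcases Nat.eq_zero_or_pos i with rfl | hi
      · left
        intro y _ j hj
        obtain rfl := Nat.le_zero.1 hj
        rfl
      · exact .inr fun y hy => hy.zero_eq hp hi
    · exact .inl fun y h => absurd h hp

end Glue

/-- The words whose first letter tells whether the rest belongs to `W`. -/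
def tagged (W : Set (Fin n → Bool)) : Set (Fin (n + 1) → Bool) :=
  {x | x 0 = true ↔ Fin.tail x ∈ W}

theorem tagged_nonempty (W : Set (Fin n → Bool)) : (tagged W).Nonempty := by
  classical
  exact ⟨Fin.cons (decide ((fun _ => false) ∈ W)) fun _ => false, by simp [tagged]⟩

theorem exists_mul_lt_two_pow (m : ℕ) : ∃ n, m * (2 * (n + 3)) < 2 ^ n := by
  have key : ∀ k : ℕ, (k + 8) ^ 2 ≤ 2 ^ (k + 8) := by
    intro k
    induction k with
    | zero => norm_num
    | succ k ih =>
      have : 2 ^ (k + 1 + 8) = 2 * 2 ^ (k + 8) := by ring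
      have : (k + 1 + 8) ^ 2 ≤ 2 * (k + 8) ^ 2 := by nlinarith [Nat.zero_le k, Nat.zero_le (k ^ 2)]
      omega
  refine ⟨4 * m + 8, ?_⟩
  have := key (4 * m)
  nlinarith

/-- Two distinct sets of words can have structures realizing the same formulas of a list. -/
theorem exists_tagged_realized_iff (Obs : Agt → Set AP) (p : AP) (L : List (KCTLs AP Agt)) :
    ∃ (n : ℕ) (W W' : Set (Fin n → Bool)), W ≠ W' ∧ ∀ ξ ∈ L, ∀ i b,
      Realized Obs p (tagged W) (tagged_nonempty W) ξ b i ↔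
        Realized Obs p (tagged W') (tagged_nonempty W') ξ b i := by
  classical
  obtain ⟨n, hn⟩ := exists_mul_lt_two_pow L.length
  let table : Set (Fin n → Bool) → (Fin L.length × Bool × Fin (n + 3) → Prop) := fun W k =>
    Realized Obs p (tagged W) (tagged_nonempty W) (L.get k.1) k.2.1 k.2.2
  obtain ⟨W, W', hne, heq⟩ := Fintype.exists_ne_map_eq_of_card_lt table (by
    simpa using Nat.pow_lt_pow_right one_lt_two hn)
  refine ⟨n, W, W', hne, fun ξ hξ i b => ?_⟩
  obtain ⟨k, rfl⟩ := List.get_of_mem hξ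
  have key : ∀ i, i < n + 3 → (Realized Obs p (tagged W) (tagged_nonempty W) (L.get k) b i ↔
      Realized Obs p (tagged W') (tagged_nonempty W') (L.get k) b i) := fun i hi =>
    iff_of_eq (congrFun heq (k, b, ⟨i, hi⟩))
  by_cases hi : i < n + 3
  · exact key i hi
  · rw [realized_const (by omega), realized_const (i := i) (by omega)]
    exact key (n + 2) (by omega)

/-- The quantifier-free formula saying that `p` distinguishes two paths at time `1`, and no
longer afterwards. -/
def mergeMatrix (p : AP) : HCTLs AP Bool :=
  .next (.conj (.conj (.atom p true) (.neg (.atom p false)))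
    (.next (.neg (.untl .tt (.neg
      (.conj (.neg (.conj (.atom p true) (.neg (.atom p false))))
        (.neg (.conj (.neg (.atom p true)) (.atom p false)))))))))

/-- Some two paths differ on `p` at time `1` and agree on `p` afterwards. -/
def mergeFormula (p : AP) : HCTLs AP Bool :=
  .ex true (.ex false (mergeMatrix p))

theorem mergeFormula_isHyperLTL (p : AP) : (mergeFormula p).isHyperLTL := by
  constructor
  · exact .exq (.exq (.qf (by simp [mergeMatrix, HCTLs.quantFree])))
  · simp [mergeFormula, mergeMatrix, HCTLs.isSentence, HCTLs.closedIn]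

theorem models_mergeFormula_iff {T : Set (Fin (n + 1) → Bool)} {hT : T.Nonempty} :
    HCTLs.models (structOf p T hT) (mergeFormula p) ↔
      ∃ x ∈ T, ∃ y ∈ T, x 0 = true ∧ y 0 = false ∧ Fin.tail x = Fin.tail y := by
  have key : ∀ (A : Bool → ℕ → State n) (x y : Fin (n + 1) → Bool) (v : Bool),
      A true = path x → A false = path y →
      (HCTLs.sat (structOf p T hT) (mergeMatrix p) A v 0 ↔
        x 0 = true ∧ y 0 = false ∧ Fin.tail x = Fin.tail y) := by
    intro A x y v hx hy
    have ht : ∀ i, p ∈ (structOf p T hT).V (A true i) ↔ bit x i := fun i => by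
      rw [hx, mem_V_path]; simp
    have hf : ∀ i, p ∈ (structOf p T hT).V (A false i) ↔ bit y i := fun i => by
      rw [hy, mem_V_path]; simp
    have htail : (∀ j, 2 ≤ j → (bit x j ↔ bit y j)) ↔ Fin.tail x = Fin.tail y := by
      constructor
      · intro h
        funext k
        have := h (k.1 + 1 + 1) (by omega)
        simp only [bit, Nat.add_lt_add_iff_right, k.2, exists_true_left] at this
        exact Bool.eq_iff_iff.2 this
      · intro h j hj
        obtain ⟨k, rfl⟩ : ∃ k, j = k + 1 + 1 := ⟨j - 2, by omega⟩
        simp only [bit, Nat.add_lt_add_iff_right]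
        refine exists_congr fun hk => ?_
        exact Bool.eq_iff_iff.1 (congrFun h ⟨k, hk⟩)
    rw [← htail]
    simp only [mergeMatrix, HCTLs.sat, ht, hf]
    have hx1 : bit x (0 + 1) ↔ x 0 = true := by simp [bit]
    have hy1 : ¬ bit y (0 + 1) ↔ y 0 = false := by simp [bit]
    rw [hy1, hx1, and_assoc]
    refine and_congr_right fun _ => and_congr_right fun _ => ?_
    constructor
    · intro h j hj
      by_contra hne
      exact h ⟨j, hj, by tauto, fun _ _ _ => trivial⟩
    · rintro h ⟨j, hj, hne, -⟩
      have := h j hj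
      tauto
  constructor
  · rintro ⟨A, v, -, px, hpx, -, py, hpy, -, h⟩
    obtain ⟨x, hx, rfl⟩ := (isInit_iff _).1 hpx
    obtain ⟨y, hy, rfl⟩ := (isInit_iff _).1 hpy
    exact ⟨x, hx, y, hy, (key _ x y _ rfl rfl).1 h⟩
  · rintro ⟨x, hx, y, hy, h⟩
    have hpx := (isInit_iff (p := p) (hT := hT) _).2 ⟨x, hx, rfl⟩
    have hpy := (isInit_iff (p := p) (hT := hT) _).2 ⟨y, hy, rfl⟩
    refine ⟨fun _ => path x, true, fun _ => hpx, path x, hpx, fun _ _ => rfl, path y, hpy, ?_, ?_⟩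
    · intro j hj
      obtain rfl := Nat.le_zero.1 hj
      rfl
    · exact (key _ x y _ rfl rfl).2 h

theorem not_models_mergeFormula_tagged (p : AP) (W : Set (Fin n → Bool)) :
    ¬ HCTLs.models (structOf p (tagged W) (tagged_nonempty W)) (mergeFormula p) := by
  rw [models_mergeFormula_iff]
  rintro ⟨x, hx, y, hy, hx0, hy0, h⟩
  simp only [tagged, Set.mem_ofPred_eq] at hx hy
  rw [h, ← hy, hx0, hy0] at hx
  simp at hx

end BranchingTraces

open BranchingTraces in
/-- **HyperLTL is not subsumed by KCTL\* over finite Kripke structures**: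
there is a HyperLTL sentence `φ` (over two path variables) such that for every
observation map `Obs` and every KCTL* sentence `ψ` there is a finite Kripke
structure `K` on which `K ⊨ φ` and `(K, Obs) ⊨ ψ` disagree. -/
theorem hyperLTL_not_subsumed_by_KCTLstar (AP Agt : Type) (p : AP) :
    ∃ φ : HCTLs AP Bool, HCTLs.isHyperLTL φ ∧
      ∀ (Obs : Agt → Set AP) (ψ : KCTLs AP Agt), KCTLs.isSentence ψ →
        ∃ K : Kripke AP, Finite K.S ∧
          ¬ (HCTLs.models K φ ↔ KCTLs.models K Obs ψ) := by
  refine ⟨mergeFormula p, mergeFormula_isHyperLTL p, fun Obs ψ _ => ?_⟩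
  obtain ⟨n, W, W', hne, hW⟩ := exists_tagged_realized_iff Obs p (ψ :: quantified ψ)
  obtain ⟨W, W', ⟨w, hw, hw'⟩, hW⟩ : ∃ W W' : Set (Fin n → Bool), (∃ w, w ∈ W ∧ w ∉ W') ∧
      ∀ ξ ∈ ψ :: quantified ψ, ∀ i b,
        Realized Obs p (tagged W) (tagged_nonempty W) ξ b i ↔
          Realized Obs p (tagged W') (tagged_nonempty W') ξ b i := by
    by_cases h : W ⊆ W'
    · exact ⟨W', W, Set.not_subset.1 fun h' => hne (h.antisymm h'),
        fun ξ hξ i b => (hW ξ hξ i b).symm⟩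
    · exact ⟨W, W', Set.not_subset.1 h, hW⟩
  let F : Bool → Set (Fin n → Bool) := fun b => if b then W else W'
  let T : Bool → Set (Fin (n + 1) → Bool) := fun b => tagged (F b)
  have hT : ∀ b, (T b).Nonempty := fun b => tagged_nonempty (F b)
  have hreal : ∀ ξ ∈ ψ :: quantified ψ, ∀ i b c c',
      Realized Obs p (T c) (hT c) ξ b i ↔ Realized Obs p (T c') (hT c') ξ b i := by
    intro ξ hξ i b c c'
    have h := hW ξ hξ i b
    cases c <;> cases c'
    · rfl
    · exact h.symm
    · exact h
    · rfl
  have hx : (Fin.cons true w : Fin (n + 1) → Bool) ∈ glue T := by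
    simpa [glue, T, F, tagged] using hw
  have hy : (Fin.cons false w : Fin (n + 1) → Bool) ∈ glue T := by
    simpa [glue, T, F, tagged] using hw'
  have hG : (glue T).Nonempty := ⟨_, hx⟩
  have hmerge : HCTLs.models (structOf p (glue T) hG) (mergeFormula p) :=
    models_mergeFormula_iff.2 ⟨_, hx, _, hy, by simp⟩
  have hiff : KCTLs.models (structOf p (glue T) hG) Obs ψ ↔
      KCTLs.models (structOf p (T true) (hT true)) Obs ψ := by
    rw [models_iff, models_iff]
    exact exists_glue_iff (hreal ψ (List.mem_cons_self ..) 0)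
      (sat_glue_iff ψ (fun ξ hξ => hreal ξ (List.mem_cons_of_mem _ hξ)) 0) true
  by_cases h : KCTLs.models (structOf p (T true) (hT true)) Obs ψ
  · exact ⟨_, inferInstanceAs (Finite (State n)), fun hK =>
      not_models_mergeFormula_tagged p (F true) (hK.2 h)⟩
  · exact ⟨_, inferInstanceAs (Finite (State n)), fun hK => h (hiff.1 (hK.1 hmerge))⟩
end

section
/- KLTL is not subsumed by HyperCTL* over finite Kripke structures: there exist a KLTL sentence ψ (one may take ψ := ∀ X F K_a ¬p) and an observation map Obs such that for every HyperCTL* sentence φ there is a finite Kripke structure K with ( K ⊨ φ ) not equivalent to ( (K,Obs) ⊨ ψ ). -/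
/-- Linear temporal formulas over words whose letters mark at most one row. -/
inductive RowLTL (R : Type) where
  | bool : Bool → RowLTL R
  | atom : R → RowLTL R
  | neg : RowLTL R → RowLTL R
  | conj : RowLTL R → RowLTL R → RowLTL R
  | next : RowLTL R → RowLTL R
  | untl : RowLTL R → RowLTL R → RowLTL R

namespace RowLTL

variable {R : Type}

/-- Size of a formula. -/
def size : RowLTL R → ℕ
  | .bool _ => 1
  | .atom _ => 1
  | .neg φ => φ.size + 1
  | .conj φ ψ => φ.size + ψ.size + 1
  | .next φ => φ.size + 1
  | .untl φ ψ => φ.size + ψ.size + 1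

/-- Satisfaction at a position of a word. -/
def sat (v : ℕ → Option R) : RowLTL R → ℕ → Prop
  | .bool b, _ => b = true
  | .atom r, i => v i = some r
  | .neg φ, i => ¬ sat v φ i
  | .conj φ ψ, i => sat v φ i ∧ sat v ψ i
  | .next φ, i => sat v φ (i + 1)
  | .untl φ ψ, i => ∃ j, i ≤ j ∧ sat v ψ j ∧ ∀ k, i ≤ k → k < j → sat v φ k

/-- The rows occurring in a formula. -/
def rows [DecidableEq R] : RowLTL R → Finset R
  | .bool _ => ∅
  | .atom r => {r}
  | .neg φ => φ.rows
  | .conj φ ψ => φ.rows ∪ ψ.rows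
  | .next φ => φ.rows
  | .untl φ ψ => φ.rows ∪ ψ.rows

theorem size_pos (χ : RowLTL R) : 0 < χ.size := by
  cases χ <;> simp [size]

theorem card_rows_le [DecidableEq R] (χ : RowLTL R) : χ.rows.card ≤ χ.size := by
  induction χ with
  | bool b => simp [rows]
  | atom r => simp [rows, size]
  | neg φ ih => simp only [rows, size]; omega
  | next φ ih => simp only [rows, size]; omega
  | conj φ ψ ih₁ ih₂ | untl φ ψ ih₁ ih₂ =>
    have := Finset.card_union_le φ.rows ψ.rows
    simp only [rows, size]; omega

theorem sat_congr [DecidableEq R] {v v' : ℕ → Option R} (χ : RowLTL R)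
    (h : ∀ r ∈ χ.rows, ∀ i, v i = some r ↔ v' i = some r) (i : ℕ) :
    sat v χ i ↔ sat v' χ i := by
  induction χ generalizing i with
  | bool b => rfl
  | atom r => exact h r (by simp [rows]) i
  | neg φ ih => simp only [sat, ih h]
  | next φ ih => simp only [sat, ih h]
  | conj φ ψ ih₁ ih₂ | untl φ ψ ih₁ ih₂ =>
    have h₁ := ih₁ fun r hr => h r (Finset.mem_union_left _ hr)
    have h₂ := ih₂ fun r hr => h r (Finset.mem_union_right _ hr)
    simp only [sat, h₁, h₂]

theorem finite_size_le [Finite R] (n : ℕ) : {χ : RowLTL R | χ.size ≤ n}.Finite := by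
  induction n with
  | zero =>
    convert Set.finite_empty
    ext χ
    simpa using χ.size_pos.ne'
  | succ n ih =>
    refine ((Set.finite_range bool).union <| (Set.finite_range atom).union <|
      (ih.image neg).union <| (ih.image next).union <|
      (ih.image2 conj ih).union (ih.image2 untl ih)).subset ?_
    intro χ hχ
    cases χ with
    | bool b => exact Or.inl ⟨b, rfl⟩
    | atom r => exact Or.inr (Or.inl ⟨r, rfl⟩)
    | neg φ =>
      exact Or.inr (Or.inr (Or.inl ⟨φ, Nat.le_of_succ_le_succ hχ, rfl⟩))
    | next φ =>
      exact Or.inr (Or.inr (Or.inr (Or.inl ⟨φ, Nat.le_of_succ_le_succ hχ, rfl⟩)))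
    | conj φ ψ =>
      have h : φ.size + ψ.size + 1 ≤ n + 1 := hχ
      exact Or.inr (Or.inr (Or.inr (Or.inr (Or.inl
        ⟨φ, by simp only [Set.mem_ofPred_eq]; omega,
          ψ, by simp only [Set.mem_ofPred_eq]; omega, rfl⟩))))
    | untl φ ψ =>
      have h : φ.size + ψ.size + 1 ≤ n + 1 := hχ
      exact Or.inr (Or.inr (Or.inr (Or.inr (Or.inr
        ⟨φ, by simp only [Set.mem_ofPred_eq]; omega,
          ψ, by simp only [Set.mem_ofPred_eq]; omega, rfl⟩))))

/-- Every finite word of length `m` occurs infinitely often in `t`. -/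
def Rich (m : ℕ) (t : ℕ → R) : Prop :=
  ∀ (s : ℕ → R) (i : ℕ), ∃ k, i ≤ k ∧ ∀ j < m, t (k + j) = s j

theorem Rich.mono {m m' : ℕ} (h : m ≤ m') {t : ℕ → R} (ht : Rich m' t) : Rich m t :=
  fun s i => (ht s i).imp fun _ hk => ⟨hk.1, fun j hj => hk.2 j (hj.trans_le h)⟩

theorem Rich.update {m : ℕ} {t : ℕ → R} (ht : Rich m t) (N : ℕ) (r : R) :
    Rich m (Function.update t N r) := by
  intro s i
  obtain ⟨k, hk, h⟩ := ht s (max i (N + 1))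
  refine ⟨k, by omega, fun j hj => ?_⟩
  rw [Function.update_of_ne (by omega), h j hj]

/-- On `m`-rich words the truth value of `χ` is determined by a finite prefix. -/
def PrefixDetermined (χ : RowLTL R) (m : ℕ) : Prop :=
  ∀ t : ℕ → R, Rich m t → ∀ i, ∃ n, ∀ t' : ℕ → R, Rich m t' → ∀ i',
    (∀ k < n, t' (i' + k) = t (i + k)) →
      (sat (fun k => some (t' k)) χ i' ↔ sat (fun k => some (t k)) χ i)

theorem PrefixDetermined.mono {χ : RowLTL R} {m m' : ℕ} (h : m ≤ m')
    (hχ : PrefixDetermined χ m) : PrefixDetermined χ m' :=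
  fun t ht i => (hχ t (ht.mono h) i).imp fun _ hn t' ht' => hn t' (ht'.mono h)

theorem untl_congr_of_agree {φ ψ : RowLTL R} {v v' : ℕ → Option R} {i i' k : ℕ}
    (hk : sat v ψ (i + k) ∨ ¬ sat v φ (i + k))
    (hφ : ∀ j ≤ k, sat v' φ (i' + j) ↔ sat v φ (i + j))
    (hψ : ∀ j ≤ k, sat v' ψ (i' + j) ↔ sat v ψ (i + j)) :
    sat v' (.untl φ ψ) i' ↔ sat v (.untl φ ψ) i := by
  have key : ∀ (w w' : ℕ → Option R) (a a' : ℕ),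
      (sat w ψ (a + k) ∨ ¬ sat w φ (a + k)) →
      (∀ j ≤ k, sat w' φ (a' + j) ↔ sat w φ (a + j)) →
      (∀ j ≤ k, sat w' ψ (a' + j) ↔ sat w ψ (a + j)) →
      sat w (.untl φ ψ) a → sat w' (.untl φ ψ) a' := by
    rintro w w' a a' hk hφ hψ ⟨j, hj, h₁, h₂⟩
    obtain ⟨d, rfl⟩ := Nat.exists_eq_add_of_le hj
    have bounded : ∀ e ≤ k, sat w ψ (a + e) → (∀ l < e, sat w φ (a + l)) →
        sat w' (.untl φ ψ) a' := by
      intro e he h₃ h₄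
      refine ⟨a' + e, by omega, (hψ e he).2 h₃, fun l hl hl' => ?_⟩
      obtain ⟨b, rfl⟩ := Nat.exists_eq_add_of_le hl
      exact (hφ b (by omega)).2 (h₄ b (by omega))
    rcases le_or_gt d k with hd | hd
    · exact bounded d hd h₁ fun l hl => h₂ _ (by omega) (by omega)
    · rcases hk with hk | hk
      · exact bounded k le_rfl hk fun l hl => h₂ _ (by omega) (by omega)
      · exact absurd (h₂ _ (by omega) (by omega)) hk
  refine ⟨key v' v i' i ?_ (fun j hj => (hφ j hj).symm) fun j hj => (hψ j hj).symm,
    key v v' i i' hk hφ hψ⟩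
  rwa [hφ k le_rfl, hψ k le_rfl]

theorem PrefixDetermined.exists_bound {χ : RowLTL R} {m : ℕ} (hχ : PrefixDetermined χ m)
    {t : ℕ → R} (ht : Rich m t) (i k : ℕ) :
    ∃ n, ∀ t' : ℕ → R, Rich m t' → ∀ i', (∀ j < n, t' (i' + j) = t (i + j)) →
      ∀ j ≤ k, (sat (fun k => some (t' k)) χ (i' + j) ↔
        sat (fun k => some (t k)) χ (i + j)) := by
  choose n hn using hχ t ht
  refine ⟨(Finset.range (k + 1)).sup (fun j => j + n (i + j)), fun t' ht' i' h j hj => ?_⟩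
  refine hn (i + j) t' ht' (i' + j) fun l hl => ?_
  have := Finset.le_sup (f := fun j => j + n (i + j)) (Finset.mem_range.2 (show j < k + 1 by omega))
  rw [add_assoc, add_assoc]
  exact h (j + l) (by omega)

theorem exists_prefixDetermined (χ : RowLTL R) : ∃ m, PrefixDetermined χ m := by
  induction χ with
  | bool b => exact ⟨0, fun _ _ _ => ⟨0, fun _ _ _ _ => Iff.rfl⟩⟩
  | atom r =>
    refine ⟨0, fun t _ i => ⟨1, fun t' _ i' h => ?_⟩⟩
    have := h 0 one_pos
    simp only [add_zero] at this
    simp only [sat, this]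
  | neg φ ih =>
    obtain ⟨m, hm⟩ := ih
    exact ⟨m, fun t ht i => (hm t ht i).imp fun n hn t' ht' i' h => not_congr (hn t' ht' i' h)⟩
  | next φ ih =>
    obtain ⟨m, hm⟩ := ih
    refine ⟨m, fun t ht i => ?_⟩
    obtain ⟨n, hn⟩ := hm.exists_bound ht i 1
    exact ⟨n, fun t' ht' i' h => hn t' ht' i' h 1 le_rfl⟩
  | conj φ ψ ih₁ ih₂ =>
    obtain ⟨m₁, h₁⟩ := ih₁
    obtain ⟨m₂, h₂⟩ := ih₂
    have h₁ := h₁.mono (le_max_left m₁ m₂)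
    have h₂ := h₂.mono (le_max_right m₁ m₂)
    refine ⟨max m₁ m₂, fun t ht i => ?_⟩
    obtain ⟨n₁, hn₁⟩ := h₁ t ht i
    obtain ⟨n₂, hn₂⟩ := h₂ t ht i
    exact ⟨max n₁ n₂, fun t' ht' i' h => and_congr
      (hn₁ t' ht' i' fun k hk => h k (hk.trans_le (le_max_left _ _)))
      (hn₂ t' ht' i' fun k hk => h k (hk.trans_le (le_max_right _ _)))⟩
  | untl φ ψ ih₁ ih₂ =>
    obtain ⟨m₁, h₁⟩ := ih₁
    obtain ⟨m₂, h₂⟩ := ih₂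
    have h₁ := h₁.mono (le_max_left m₁ m₂)
    have h₂ := h₂.mono (le_max_right m₁ m₂)
    set m := max m₁ m₂
    by_cases hex : ∃ t : ℕ → R, Rich m t ∧ ∃ i,
        (sat (fun k => some (t k)) ψ i ∨ ¬ sat (fun k => some (t k)) φ i)
    · obtain ⟨s, hs, a, ha⟩ := hex
      obtain ⟨n₁, hn₁⟩ := h₁ s hs a
      obtain ⟨n₂, hn₂⟩ := h₂ s hs a
      have hm : m ≤ max m (max n₁ n₂) := le_max_left _ _
      refine ⟨max m (max n₁ n₂), fun t ht i => ?_⟩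
      obtain ⟨k, hik, hk⟩ := ht (fun j => s (a + j)) i
      obtain ⟨d, rfl⟩ := Nat.exists_eq_add_of_le hik
      have hd : sat (fun k => some (t k)) ψ (i + d) ∨ ¬ sat (fun k => some (t k)) φ (i + d) := by
        rwa [hn₁ t (ht.mono hm) (i + d) fun j hj => hk j (by omega),
          hn₂ t (ht.mono hm) (i + d) fun j hj => hk j (by omega)]
      obtain ⟨l₁, hl₁⟩ := h₁.exists_bound (ht.mono hm) i d
      obtain ⟨l₂, hl₂⟩ := h₂.exists_bound (ht.mono hm) i d
      exact ⟨max l₁ l₂, fun t' ht' i' h => untl_congr_of_agree hd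
        (hl₁ t' (ht'.mono hm) i' fun k hk => h k (hk.trans_le (le_max_left _ _)))
        (hl₂ t' (ht'.mono hm) i' fun k hk => h k (hk.trans_le (le_max_right _ _)))⟩
    · push Not at hex
      have hfalse : ∀ t : ℕ → R, Rich m t → ∀ i,
          ¬ sat (fun k => some (t k)) (.untl φ ψ) i := by
        rintro t ht i ⟨j, -, hj, -⟩
        exact (hex t ht j).1 hj
      exact ⟨m, fun t ht i => ⟨0, fun t' ht' i' _ => iff_of_false (hfalse t' ht' i')
        (hfalse t ht i)⟩⟩

theorem exists_periodic_rich [Finite R] [Nonempty R] (m : ℕ) :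
    ∃ (P : ℕ) (t : ℕ → R), 0 < P ∧ (∀ i, t (i + P) = t i) ∧ Rich m t := by
  suffices H : ∀ m, 0 < m → ∃ (P : ℕ) (t : ℕ → R), 0 < P ∧ (∀ i, t (i + P) = t i) ∧ Rich m t by
    obtain ⟨P, t, h₁, h₂, h₃⟩ := H (m + 1) m.succ_pos
    exact ⟨P, t, h₁, h₂, h₃.mono m.le_succ⟩
  intro m hm
  obtain ⟨C, ⟨e⟩⟩ := Finite.exists_equiv_fin (Fin m → R)
  have hC : 0 < C := by
    have : Nonempty (Fin m → R) := inferInstance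
    exact (e this.some).pos
  refine ⟨m * C, fun i => e.symm ⟨i / m % C, Nat.mod_lt _ hC⟩ ⟨i % m, Nat.mod_lt _ hm⟩,
    Nat.mul_pos hm hC, fun i => ?_, fun s i => ?_⟩
  · simp only [Nat.add_mul_div_left _ _ hm, Nat.add_mod_right, Nat.add_mul_mod_self_left]
  · set c := e fun j => s j
    refine ⟨m * (C * i + c), ?_, fun j hj => ?_⟩
    · have h₁ : i ≤ C * i := Nat.le_mul_of_pos_left i hC
      have h₂ : C * i + c ≤ m * (C * i + c) := Nat.le_mul_of_pos_left _ hm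
      omega
    · have h₁ : (m * (C * i + c) + j) / m = C * i + c := by
        rw [Nat.mul_add_div hm, Nat.div_eq_of_lt hj, add_zero]
      have h₂ : (m * (C * i + c) + j) % m = j := by
        rw [Nat.mul_add_mod, Nat.mod_eq_of_lt hj]
      have h₃ : (C * i + c) % C = c := by
        rw [Nat.mul_add_mod, Nat.mod_eq_of_lt c.isLt]
      simp only [h₁, h₂, h₃, Fin.eta]
      simp [c]

/-- Formulas of size at most `n` cannot detect an unmarked letter in a suitable periodic
word over more than `n` rows. -/
theorem exists_word_erase_equiv (n : ℕ) :
    ∃ (P : ℕ) (t : ℕ → Fin (n + 1)) (N : ℕ), 0 < P ∧ (∀ i, t (i + P) = t i) ∧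
      ∀ χ : RowLTL (Fin (n + 1)), χ.size ≤ n →
        (sat (fun k => some (t k)) χ 0 ↔
          sat (Function.update (fun k => some (t k)) N none) χ 0) := by
  have hfin := finite_size_le (R := Fin (n + 1)) n
  choose m hm using exists_prefixDetermined (R := Fin (n + 1))
  obtain ⟨P, t, hP, hper, hrich⟩ := exists_periodic_rich (R := Fin (n + 1)) (hfin.toFinset.sup m)
  have hdet : ∀ χ : RowLTL (Fin (n + 1)), χ.size ≤ n →
      PrefixDetermined χ (hfin.toFinset.sup m) := fun χ hχ =>
    (hm χ).mono (Finset.le_sup (f := m) (hfin.mem_toFinset.2 hχ))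
  have hlen : ∀ χ : RowLTL (Fin (n + 1)), ∃ l, χ.size ≤ n → ∀ t' : ℕ → Fin (n + 1),
      Rich (hfin.toFinset.sup m) t' → (∀ k < l, t' k = t k) →
        (sat (fun k => some (t' k)) χ 0 ↔ sat (fun k => some (t k)) χ 0) := by
    intro χ
    by_cases hχ : χ.size ≤ n
    · obtain ⟨l, hl⟩ := hdet χ hχ t hrich 0
      exact ⟨l, fun _ t' ht' h => hl t' ht' 0 (by simpa using h)⟩
    · exact ⟨0, fun h => absurd h hχ⟩
  choose l hl using hlen
  refine ⟨P, t, hfin.toFinset.sup l, hP, hper, fun χ hχ => ?_⟩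
  set N := hfin.toFinset.sup l
  have hN : l χ ≤ N := Finset.le_sup (f := l) (hfin.mem_toFinset.2 hχ)
  obtain ⟨r, -, hr⟩ := Finset.exists_mem_notMem_of_card_lt_card
    (s := χ.rows) (t := Finset.univ) (by
      have := χ.card_rows_le
      simp only [Finset.card_univ, Fintype.card_fin]
      omega)
  rw [← hl χ hχ (Function.update t N r) (hrich.update N r) fun k hk =>
    Function.update_of_ne (by omega) _ _]
  refine sat_congr χ (fun q hq i => ?_) 0
  rcases eq_or_ne i N with rfl | hi
  · have : r ≠ q := fun h => hr (h ▸ hq)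
    simp [this]
  · simp [hi]

end RowLTL

theorem exists_le_and_iff_or_succ (P Q : ℕ → Prop) (i : ℕ) :
    (∃ j, i ≤ j ∧ Q j ∧ ∀ k, i ≤ k → k < j → P k) ↔
      Q i ∨ P i ∧ ∃ j, i + 1 ≤ j ∧ Q j ∧ ∀ k, i + 1 ≤ k → k < j → P k := by
  constructor
  · rintro ⟨j, hj, h₁, h₂⟩
    rcases hj.eq_or_lt with rfl | hj
    · exact Or.inl h₁
    · exact Or.inr ⟨h₂ i le_rfl hj, j, hj, h₁, fun k hk => h₂ k (by omega)⟩
  · rintro (h | ⟨h, j, hj, h₁, h₂⟩)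
    · exact ⟨i, le_rfl, h, fun k hk hk' => absurd hk hk'.not_ge⟩
    · refine ⟨j, by omega, h₁, fun k hk hk' => ?_⟩
      rcases hk.eq_or_lt with rfl | hk
      · exact h
      · exact h₂ k hk hk'

/-- The `i`-th suffix of a word. -/
def wordSuffix {α : Type} (v : ℕ → α) (i : ℕ) : ℕ → α := fun k => v (i + k)

/-- The Kripke structure that branches at the initial state into one deterministic path per
row; `p` holds on the path of row `r` at the positions where `v` carries the letter `r`. -/
def rowKripke {AP R : Type} (p : AP) [Nonempty R] (v : ℕ → Option R) : Kripke AP where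
  S := Option (Set.range (wordSuffix v) × R)
  s0 := none
  E
    | none, some (q, _) => q.1 = wordSuffix v 0
    | some (q, r), some (q', r') => q'.1 = wordSuffix q.1 1 ∧ r' = r
    | _, none => False
  total
    | none => ⟨some (⟨_, 0, rfl⟩, Classical.arbitrary R), rfl⟩
    | some (⟨_, ⟨i, hi⟩⟩, r) =>
      ⟨some (⟨_, i + 1, rfl⟩, r), by
        subst hi
        exact ⟨by funext k; simp [wordSuffix, add_assoc], rfl⟩⟩
  V
    | none => ∅
    | some (q, r) => {x | x = p ∧ q.1 0 = some r}

section toRowLTL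

variable {AP R Var : Type} [DecidableEq Var] (p : AP)

open Classical in
/-- Once paths have separated, a path quantifier can only copy the current path. -/
noncomputable def HCTLs.toRowLTL : HCTLs AP Var → (Var → R) → R → RowLTL R
  | .tt, _, _ => .bool true
  | .atom q x, ρ, _ => if q = p then .atom (ρ x) else .bool false
  | .neg φ, ρ, c => .neg (φ.toRowLTL ρ c)
  | .conj φ ψ, ρ, c => .conj (φ.toRowLTL ρ c) (ψ.toRowLTL ρ c)
  | .next φ, ρ, c => .next (φ.toRowLTL ρ c)
  | .untl φ ψ, ρ, c => .untl (φ.toRowLTL ρ c) (ψ.toRowLTL ρ c)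
  | .ex x φ, ρ, c => φ.toRowLTL (Function.update ρ x c) c

theorem HCTLs.size_toRowLTL_le (φ : HCTLs AP Var) (ρ : Var → R) (c : R) :
    (φ.toRowLTL p ρ c).size ≤ φ.size := by
  induction φ generalizing ρ with
  | tt => exact le_rfl
  | atom q x =>
    rw [HCTLs.toRowLTL]
    split_ifs <;> exact le_rfl
  | neg φ ih => exact Nat.succ_le_succ (ih ρ)
  | next φ ih => exact Nat.succ_le_succ (ih ρ)
  | conj φ ψ ih₁ ih₂ => exact Nat.succ_le_succ (Nat.add_le_add (ih₁ ρ) (ih₂ ρ))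
  | untl φ ψ ih₁ ih₂ => exact Nat.succ_le_succ (Nat.add_le_add (ih₁ ρ) (ih₂ ρ))
  | ex x φ ih => exact (ih _).trans (Nat.le_succ _)

end toRowLTL

section rowKripke

variable {AP R : Type} (p : AP) [Nonempty R] (v : ℕ → Option R)

/-- The initial path of a row. -/
def rowPath (r : R) : ℕ → (rowKripke p v).S
  | 0 => none
  | i + 1 => some (⟨wordSuffix v i, i, rfl⟩, r)

theorem mem_rowPath_succ (q : AP) (r : R) (i : ℕ) :
    q ∈ (rowKripke p v).V (rowPath p v r (i + 1)) ↔ q = p ∧ v i = some r :=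
  Iff.rfl

theorem notMem_rowPath_zero (q : AP) (r : R) :
    q ∉ (rowKripke p v).V (rowPath p v r 0) :=
  fun h => h

theorem isInit_iff (pa : ℕ → (rowKripke p v).S) :
    (rowKripke p v).IsInit pa ↔ ∃ r, pa = rowPath p v r := by
  constructor
  · rintro ⟨h₀, h⟩
    have h₁ : ∃ r, pa 1 = rowPath p v r 1 := by
      have := h 0
      rw [h₀] at this
      rcases hp : pa 1 with _ | ⟨q, r⟩
      · rw [hp] at this; exact this.elim
      · rw [hp] at this
        refine ⟨r, ?_⟩
        exact congrArg (fun q => some (q, r)) (Subtype.ext this)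
    obtain ⟨r, h₁⟩ := h₁
    refine ⟨r, funext fun i => ?_⟩
    rcases i with _ | i
    · exact h₀
    induction i with
    | zero => exact h₁
    | succ i ih =>
      have := h (i + 1)
      rw [ih] at this
      rcases hp : pa (i + 1 + 1) with _ | ⟨q, r'⟩
      · rw [hp] at this; exact this.elim
      · rw [hp] at this
        obtain ⟨h₂, rfl⟩ : q.1 = wordSuffix (wordSuffix v i) 1 ∧ r' = r := this
        refine congrArg (fun q => some (q, r')) (Subtype.ext (h₂.trans ?_))
        funext k; simp [wordSuffix, add_assoc]
  · rintro ⟨r, rfl⟩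
    refine ⟨rfl, fun i => ?_⟩
    rcases i with _ | i
    · rfl
    · exact ⟨by funext k; simp [wordSuffix, add_assoc], rfl⟩

theorem finite_rowKripke [Finite R] {P a : ℕ} (hP : 0 < P)
    (hv : ∀ i, a ≤ i → v (i + P) = v i) : Finite (rowKripke p v).S := by
  have : (Set.range (wordSuffix v)).Finite := by
    refine ((Finset.range (a + P)).finite_toSet.image (wordSuffix v)).subset ?_
    rintro _ ⟨i, rfl⟩
    induction i using Nat.strong_induction_on with
    | _ i ih =>
      rcases lt_or_ge i (a + P) with h | h
      · exact ⟨i, by simpa using h, rfl⟩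
      · obtain ⟨j, hj, h'⟩ := ih (i - P) (by omega)
        refine ⟨j, hj, h'.trans (funext fun k => ?_)⟩
        have := hv (i - P + k) (by omega)
        simp only [wordSuffix]
        rw [← this]
        congr 1
        omega
  have := this.to_subtype
  exact inferInstanceAs (Finite (Option (Set.range (wordSuffix v) × R)))

theorem rowKripke_models_iff {Agt : Type} (a : Agt) :
    KCTLs.models (rowKripke p v) (fun _ => ∅)
      (.neg (.ex (.neg (.next (.untl .tt (.know a (.neg (.atom p))))))))
      ↔ ∃ i, v i = none := by
  simp only [KCTLs.models, KCTLs.sat, isInit_iff]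
  constructor
  · rintro ⟨_, ⟨r, rfl⟩, h⟩
    by_contra! hne
    refine h ⟨_, ⟨r, rfl⟩, fun _ _ => rfl, ?_⟩
    rintro ⟨j, hj, h, -⟩
    obtain ⟨i, rfl⟩ := Nat.exists_eq_add_of_le' hj
    obtain ⟨r', hr'⟩ := Option.ne_none_iff_exists'.1 (hne (0 + i))
    refine h (rowPath p v r') ⟨r', rfl⟩ (by simp) ?_
    have := (mem_rowPath_succ p v p r' i).2 ⟨rfl, by simpa using hr'⟩
    simpa [add_comm, add_left_comm] using this
  · rintro ⟨i, hi⟩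
    refine ⟨_, ⟨Classical.arbitrary R, rfl⟩, ?_⟩
    rintro ⟨_, -, -, h⟩
    refine h ⟨i + 1, by omega, ?_, fun _ _ _ => trivial⟩
    rintro _ ⟨r, rfl⟩ -
    rw [mem_rowPath_succ, hi]
    simp

variable {Var : Type} [DecidableEq Var]

theorem update_rowPath (ρ : Var → R) (x : Var) (r : R) :
    Function.update (fun z => rowPath p v (ρ z)) x (rowPath p v r) =
      fun z => rowPath p v (Function.update ρ x r z) :=
  (Function.comp_update (rowPath p v) ρ x r).symm

theorem sat_succ_iff (φ : HCTLs AP Var) (ρ : Var → R) (y : Var) (i : ℕ) :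
    HCTLs.sat (rowKripke p v) φ (fun x => rowPath p v (ρ x)) y (i + 1) ↔
      RowLTL.sat v (φ.toRowLTL p ρ (ρ y)) i := by
  induction φ generalizing ρ y i with
  | tt => simp [HCTLs.sat, HCTLs.toRowLTL, RowLTL.sat]
  | atom q x =>
    rw [HCTLs.sat, mem_rowPath_succ, HCTLs.toRowLTL]
    split_ifs with h <;> simp [h, RowLTL.sat]
  | neg φ ih => exact not_congr (ih ρ y i)
  | next φ ih => exact ih ρ y (i + 1)
  | conj φ ψ ih₁ ih₂ => exact and_congr (ih₁ ρ y i) (ih₂ ρ y i)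
  | untl φ ψ ih₁ ih₂ =>
    simp only [HCTLs.sat, HCTLs.toRowLTL, RowLTL.sat]
    constructor
    · rintro ⟨j, hj, h₁, h₂⟩
      obtain ⟨j, rfl⟩ := Nat.exists_eq_add_of_le' (show 1 ≤ j by omega)
      exact ⟨j, by omega, (ih₂ ρ y j).1 h₁, fun k hk hk' =>
        (ih₁ ρ y k).1 (h₂ (k + 1) (by omega) (by omega))⟩
    · rintro ⟨j, hj, h₁, h₂⟩
      refine ⟨j + 1, by omega, (ih₂ ρ y j).2 h₁, fun k hk hk' => ?_⟩
      obtain ⟨k, rfl⟩ := Nat.exists_eq_add_of_le' (show 1 ≤ k by omega)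
      exact (ih₁ ρ y k).2 (h₂ k (by omega) (by omega))
  | ex x φ ih =>
    simp only [HCTLs.sat, HCTLs.toRowLTL, isInit_iff]
    have key := ih (Function.update ρ x (ρ y)) x i
    rw [Function.update_self, ← update_rowPath] at key
    rw [← key]
    constructor
    · rintro ⟨_, ⟨r, rfl⟩, h, hs⟩
      have h₁ := h 1 (by omega)
      have hr : r = ρ y := congrArg Prod.snd (Option.some.inj h₁)
      rwa [hr] at hs
    · exact fun hs => ⟨_, ⟨ρ y, rfl⟩, fun _ _ => rfl, hs⟩

theorem sat_ex_zero_iff (x : Var) (φ : HCTLs AP Var) (ρ : Var → R) (y : Var) :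
    HCTLs.sat (rowKripke p v) (.ex x φ) (fun x => rowPath p v (ρ x)) y 0 ↔
      ∃ r, HCTLs.sat (rowKripke p v) φ
        (fun z => rowPath p v (Function.update ρ x r z)) x 0 := by
  simp only [HCTLs.sat, isInit_iff]
  constructor
  · rintro ⟨_, ⟨r, rfl⟩, -, hs⟩
    rw [update_rowPath] at hs
    exact ⟨r, hs⟩
  · rintro ⟨r, hs⟩
    rw [← update_rowPath] at hs
    refine ⟨_, ⟨r, rfl⟩, fun j hj => ?_, hs⟩
    obtain rfl : j = 0 := by omega
    rfl

variable {v}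

theorem sat_zero_congr {v' : ℕ → Option R} {n : ℕ}
    (h : ∀ χ : RowLTL R, χ.size ≤ n → (RowLTL.sat v χ 0 ↔ RowLTL.sat v' χ 0))
    (φ : HCTLs AP Var) (hφ : φ.size ≤ n) (ρ : Var → R) (y : Var) :
    HCTLs.sat (rowKripke p v) φ (fun x => rowPath p v (ρ x)) y 0 ↔
      HCTLs.sat (rowKripke p v') φ (fun x => rowPath p v' (ρ x)) y 0 := by
  have hone : ∀ φ : HCTLs AP Var, φ.size ≤ n →
      (HCTLs.sat (rowKripke p v) φ (fun x => rowPath p v (ρ x)) y 1 ↔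
        HCTLs.sat (rowKripke p v') φ (fun x => rowPath p v' (ρ x)) y 1) := fun φ hφ => by
    rw [sat_succ_iff p v φ ρ y 0, sat_succ_iff p v' φ ρ y 0]
    exact h _ ((φ.size_toRowLTL_le p ρ (ρ y)).trans hφ)
  induction φ generalizing ρ y with
  | tt => exact Iff.rfl
  | atom q x => exact iff_of_false (notMem_rowPath_zero p v q _) (notMem_rowPath_zero p v' q _)
  | neg φ ih =>
    simp only [HCTLs.size] at hφ
    exact not_congr (ih (by omega) ρ y hone)
  | next φ ih =>
    simp only [HCTLs.size] at hφ
    exact hone φ (by omega)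
  | conj φ ψ ih₁ ih₂ =>
    simp only [HCTLs.size] at hφ
    exact and_congr (ih₁ (by omega) ρ y hone) (ih₂ (by omega) ρ y hone)
  | untl φ ψ ih₁ ih₂ =>
    have huntl := hone _ hφ
    simp only [HCTLs.size] at hφ
    simp only [HCTLs.sat] at huntl ⊢
    rw [exists_le_and_iff_or_succ _ _ 0, exists_le_and_iff_or_succ _ _ 0]
    exact or_congr (ih₂ (by omega) ρ y hone) (and_congr (ih₁ (by omega) ρ y hone) huntl)
  | ex x φ ih =>
    simp only [HCTLs.size] at hφ
    rw [sat_ex_zero_iff, sat_ex_zero_iff]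
    refine exists_congr fun r => ih (by omega) _ _ fun φ hφ => ?_
    rw [sat_succ_iff p v φ _ x 0, sat_succ_iff p v' φ _ x 0]
    exact h _ ((φ.size_toRowLTL_le p _ _).trans hφ)

theorem models_congr {v' : ℕ → Option R} (φ : HCTLs AP Var)
    (h : ∀ χ : RowLTL R, χ.size ≤ φ.size → (RowLTL.sat v χ 0 ↔ RowLTL.sat v' χ 0)) :
    HCTLs.models (rowKripke p v) φ ↔ HCTLs.models (rowKripke p v') φ := by
  have models_iff : ∀ w : ℕ → Option R, HCTLs.models (rowKripke p w) φ ↔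
      ∃ (ρ : Var → R) (y : Var),
        HCTLs.sat (rowKripke p w) φ (fun x => rowPath p w (ρ x)) y 0 := by
    intro w
    constructor
    · rintro ⟨A, y, hA, hs⟩
      choose ρ hρ using fun x => (isInit_iff p w (A x)).1 (hA x)
      obtain rfl : A = fun x => rowPath p w (ρ x) := funext hρ
      exact ⟨ρ, y, hs⟩
    · rintro ⟨ρ, y, hs⟩
      exact ⟨_, y, fun x => (isInit_iff p w _).2 ⟨ρ x, rfl⟩, hs⟩
  rw [models_iff, models_iff]
  exact exists_congr fun ρ => exists_congr fun y => sat_zero_congr p h φ le_rfl ρ y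

end rowKripke

/-- **KLTL is not subsumed by HyperCTL\* over finite Kripke structures**:
there are a KLTL sentence `ψ` and an observation map `Obs` such that for every
HyperCTL* sentence `φ` (over any set of path variables) there is a finite Kripke
structure `K` on which `K ⊨ φ` and `(K, Obs) ⊨ ψ` disagree. -/
theorem KLTL_not_subsumed_by_HyperCTLstar (AP Agt : Type) (p : AP) (a : Agt) :
    ∃ (ψ : KCTLs AP Agt) (Obs : Agt → Set AP), KCTLs.isKLTL ψ ∧
      ∀ (Var : Type) [DecidableEq Var] (φ : HCTLs AP Var), HCTLs.isSentence φ →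
        ∃ K : Kripke AP, Finite K.S ∧
          ¬ (HCTLs.models K φ ↔ KCTLs.models K Obs ψ) := by
  refine ⟨.neg (.ex (.neg (.next (.untl .tt (.know a (.neg (.atom p))))))), fun _ => ∅,
    by simp [KCTLs.isKLTL, KCTLs.quantFree], fun Var _ φ _ => ?_⟩
  by_contra! hall
  obtain ⟨P, t, N, hP, hper, heq⟩ := RowLTL.exists_word_erase_equiv φ.size
  have hfull := hall (rowKripke p fun k => some (t k))
    (finite_rowKripke p _ (a := 0) hP fun i _ => congrArg some (hper i))
  have herased := hall (rowKripke p (Function.update (fun k => some (t k)) N none))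
    (finite_rowKripke p _ (a := N + 1) hP fun i hi => by
      rw [Function.update_of_ne (by omega), Function.update_of_ne (by omega), hper])
  rw [rowKripke_models_iff] at hfull herased
  rw [models_congr p φ heq] at hfull
  obtain ⟨i, hi⟩ := hfull.1 (herased.2 ⟨N, by simp⟩)
  cases hi
end

section
/- For every n>1 and every regular tree structure K_n over 2^{{p}} satisfying the defining conditions (for some ℓ_n>1), K_n satisfies the HyperLTL sentence φ_p := ∃x.∃y.( p[x] U ( (p[x]∧¬p[y]) ∧ XG(p[x]↔p[y]) ) ). -/
/-- A tree structure: a Kripke structure whose state set is a prefix-closed set of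
words over ℕ, with root `[]` as initial state and edges only from a node `τ` to
children `τ ++ [i]`. -/
structure TreeKripke (AP : Type) where
  nodes : Set (List ℕ)
  root_mem : ([] : List ℕ) ∈ nodes
  prefix_closed : ∀ ⦃τ τ' : List ℕ⦄, τ ∈ nodes → τ' <+: τ → τ' ∈ nodes
  edge : List ℕ → List ℕ → Prop
  edge_mem_l : ∀ ⦃τ τ' : List ℕ⦄, edge τ τ' → τ ∈ nodes
  edge_mem_r : ∀ ⦃τ τ' : List ℕ⦄, edge τ τ' → τ' ∈ nodes
  edge_child : ∀ ⦃τ τ' : List ℕ⦄, edge τ τ' → ∃ i, τ' = τ ++ [i]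
  total : ∀ τ ∈ nodes, ∃ τ', edge τ τ'
  V : List ℕ → Set AP

/-- `pa` is an initial path of the tree structure `T`. -/
def TreeKripke.TInit {AP : Type} (T : TreeKripke AP) (pa : ℕ → List ℕ) : Prop :=
  pa 0 = [] ∧ ∀ i, T.edge (pa i) (pa (i + 1))

/-- A Kripke structure whose states are natural numbers (used to define unwindings,
and hence regular tree structures). -/
structure NKripke (AP : Type) where
  states : Set ℕ
  s0 : ℕ
  s0_mem : s0 ∈ states
  E : ℕ → ℕ → Prop
  E_mem : ∀ ⦃s t⦄, E s t → s ∈ states ∧ t ∈ states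
  total : ∀ s ∈ states, ∃ t, E s t
  V : ℕ → Set AP

/-- A tree structure is regular if it is the unwinding of a finite Kripke structure:
its nodes are the finite paths from the initial state (coded by the lists of visited
states), all parent-child pairs are edges, and labels come from the labels of the
corresponding states. -/
def IsRegularTree {AP : Type} (T : TreeKripke AP) : Prop :=
  ∃ K : NKripke AP, K.states.Finite ∧
    T.nodes = {τ : List ℕ | List.Chain' K.E (K.s0 :: τ)} ∧
    (∀ τ τ', T.edge τ τ' ↔ (τ ∈ T.nodes ∧ τ' ∈ T.nodes ∧ ∃ i, τ' = τ ++ [i])) ∧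
    (∀ τ ∈ T.nodes, T.V τ = K.V ((K.s0 :: τ).getLast (List.cons_ne_nil _ _)))
/-- Satisfaction of HyperCTL* over a tree structure `T` (paths are raw sequences of
nodes). -/
def HCTLs.satT {AP Var : Type} [DecidableEq Var] (T : TreeKripke AP) :
    HCTLs AP Var → (Var → (ℕ → List ℕ)) → Var → ℕ → Prop
  | .tt, _, _, _ => True
  | .atom p x, A, _, i => p ∈ T.V (A x i)
  | .neg φ, A, y, i => ¬ HCTLs.satT T φ A y i
  | .conj φ ψ, A, y, i => HCTLs.satT T φ A y i ∧ HCTLs.satT T ψ A y i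
  | .next φ, A, y, i => HCTLs.satT T φ A y (i + 1)
  | .untl φ ψ, A, y, i => ∃ j, i ≤ j ∧ HCTLs.satT T ψ A y j ∧
      ∀ k, i ≤ k → k < j → HCTLs.satT T φ A y k
  | .ex x φ, A, y, i => ∃ pa, T.TInit pa ∧ (∀ j, j ≤ i → pa j = A y j) ∧
      HCTLs.satT T φ (Function.update A x pa) x i

/-- `T ⊨ φ` for HyperCTL* over a tree structure `T`. -/
def HCTLs.modelsT {AP Var : Type} [DecidableEq Var] (T : TreeKripke AP)
    (φ : HCTLs AP Var) : Prop :=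
  ∃ (A : Var → (ℕ → List ℕ)) (y : Var), (∀ x, T.TInit (A x)) ∧ HCTLs.satT T φ A y 0
/-- The defining conditions of the regular tree structure `K_n` (Hyper section),
over `AP = {p}` (modelled by `Unit`), with parameter `ℓ = ℓ_n > 1`.
Words over `2^{p}` are modelled as lists of booleans. -/
structure HyperKnData (n : ℕ) (T : TreeKripke Unit) (ℓ : ℕ) where
  /-- the distinguished successor `η` of the root -/
  eta : List ℕ
  /-- the successors `ξ_1, …, ξ_{2n}` of the root -/
  xi : ℕ → List ℕ
  /-- the words `w_0, …, w_{2n}` of length `ℓ` -/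
  w : ℕ → List Bool
  /-- the unique initial path visiting `η` -/
  pEta : ℕ → List ℕ
  /-- the unique initial paths visiting `ξ_1, …, ξ_{2n}` -/
  pXi : ℕ → ℕ → List ℕ
  root_label : () ∈ T.V []
  edge_eta : T.edge [] eta
  edge_xi : ∀ k, 1 ≤ k → k ≤ 2 * n → T.edge [] (xi k)
  succ_only : ∀ τ, T.edge [] τ → τ = eta ∨ ∃ k, 1 ≤ k ∧ k ≤ 2 * n ∧ τ = xi k
  eta_ne_xi : ∀ k, 1 ≤ k → k ≤ 2 * n → eta ≠ xi k
  xi_inj : ∀ k k', 1 ≤ k → k ≤ 2 * n → 1 ≤ k' → k' ≤ 2 * n → xi k = xi k' → k = k'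
  pEta_init : T.TInit pEta
  pEta_visits : ∃ i, pEta i = eta
  pEta_unique : ∀ pa, T.TInit pa → (∃ i, pa i = eta) → pa = pEta
  pXi_init : ∀ k, 1 ≤ k → k ≤ 2 * n → T.TInit (pXi k)
  pXi_visits : ∀ k, 1 ≤ k → k ≤ 2 * n → ∃ i, pXi k i = xi k
  pXi_unique : ∀ k, 1 ≤ k → k ≤ 2 * n → ∀ pa, T.TInit pa → (∃ i, pa i = xi k) → pa = pXi k
  w_len : ∀ k, k ≤ 2 * n → (w k).length = ℓ
  w_distinct : ∀ k k', k ≤ 2 * n → k' ≤ 2 * n → k ≠ k' → w k ≠ w k'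
  w0_all : w 0 = List.replicate ℓ true
  wn_last : (w n).getD (ℓ - 1) false = false
  wn1_last : (w (n - 1)).getD (ℓ - 1) false = true
  /-- the trace of `π(η)` is `{p}·w_0·∅^n·{p}^n·{p}^ω` -/
  trace_eta₀ : () ∈ T.V (pEta 0)
  trace_eta₁ : ∀ i, 1 ≤ i → i ≤ ℓ → (() ∈ T.V (pEta i) ↔ (w 0).getD (i - 1) false = true)
  trace_eta₂ : ∀ i, ℓ + 1 ≤ i → i ≤ ℓ + n → () ∉ T.V (pEta i)
  trace_eta₃ : ∀ i, ℓ + n + 1 ≤ i → () ∈ T.V (pEta i)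
  /-- the trace of `π(ξ_k)` is `{p}·w_k·∅^{2n-k}·{p}^k·{p}^ω` -/
  trace_xi₀ : ∀ k, 1 ≤ k → k ≤ 2 * n → () ∈ T.V (pXi k 0)
  trace_xi₁ : ∀ k, 1 ≤ k → k ≤ 2 * n → ∀ i, 1 ≤ i → i ≤ ℓ →
      (() ∈ T.V (pXi k i) ↔ (w k).getD (i - 1) false = true)
  trace_xi₂ : ∀ k, 1 ≤ k → k ≤ 2 * n → ∀ i, ℓ + 1 ≤ i → i ≤ ℓ + (2 * n - k) →
      () ∉ T.V (pXi k i)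
  trace_xi₃ : ∀ k, 1 ≤ k → k ≤ 2 * n → ∀ i, ℓ + (2 * n - k) + 1 ≤ i →
      () ∈ T.V (pXi k i)

/-- `M` is obtained from `K_n` by replacing the label `{p}` of the node
`π(ξ_n)(ℓ+1+n)` with `∅`. -/
def MObtainedHyper {n ℓ : ℕ} {T : TreeKripke Unit} (M : TreeKripke Unit)
    (D : HyperKnData n T ℓ) : Prop :=
  M.nodes = T.nodes ∧ M.edge = T.edge ∧
    ∀ τ, M.V τ = if τ = D.pXi n (ℓ + 1 + n) then ∅ else T.V τ
/-- `G θ := ¬(⊤ U ¬θ)`. -/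
def HCTLs.always {AP Var : Type} (φ : HCTLs AP Var) : HCTLs AP Var :=
  .neg (.untl .tt (.neg φ))

/-- Boolean equivalence, as a derived HyperCTL* connective. -/
def HCTLs.equ {AP Var : Type} (φ ψ : HCTLs AP Var) : HCTLs AP Var :=
  .conj (.neg (.conj φ (.neg ψ))) (.neg (.conj ψ (.neg φ)))

/-- The HyperLTL sentence
`φ_p := ∃x.∃y.( p[x] U ( (p[x] ∧ ¬p[y]) ∧ X G (p[x] ↔ p[y]) ) )`,
with `x` and `y` encoded by `false` and `true`. -/
def phiP : HCTLs Unit Bool :=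
  .ex false (.ex true (.untl (.atom () false)
    (.conj (.conj (.atom () false) (.neg (.atom () true)))
      (.next (HCTLs.always (HCTLs.equ (.atom () false) (.atom () true)))))))
/-- **`K_n` satisfies `φ_p`**: for every `n > 1` and every regular tree structure
`K_n` over `2^{p}` satisfying the defining conditions (for some `ℓ_n > 1`), `K_n`
satisfies the HyperLTL sentence
`φ_p := ∃x.∃y.( p[x] U ( (p[x] ∧ ¬p[y]) ∧ X G (p[x] ↔ p[y]) ) )`. -/
theorem Kn_satisfies_phiP :
    ∀ n : ℕ, 1 < n → ∀ T : TreeKripke Unit, IsRegularTree T →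
      ∀ ℓ : ℕ, 1 < ℓ → ∀ _ : HyperKnData n T ℓ,
        HCTLs.modelsT T phiP := by
  intro n hn T _ ℓ hℓ D
  have h1 : 1 ≤ n := by omega
  have h2 : n ≤ 2 * n := by omega
  have before : ∀ i, i ≤ ℓ → () ∈ T.V (D.pEta i) := by
    intro i hi
    rcases Nat.eq_zero_or_pos i with rfl | hpos
    · exact D.trace_eta₀
    · rw [D.trace_eta₁ i hpos hi, D.w0_all,
        List.getD_eq_getElem _ _ (by simp only [List.length_replicate]; omega)]
      simp
  have differ : () ∉ T.V (D.pXi n ℓ) := by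
    rw [D.trace_xi₁ n h1 h2 ℓ (by omega) le_rfl, D.wn_last]
    simp
  have after : ∀ i, ℓ + 1 ≤ i → (() ∈ T.V (D.pEta i) ↔ () ∈ T.V (D.pXi n i)) := by
    intro i hi
    by_cases hin : i ≤ ℓ + n
    · exact iff_of_false (D.trace_eta₂ i hi hin) (D.trace_xi₂ n h1 h2 i hi (by omega))
    · exact iff_of_true (D.trace_eta₃ i (by omega)) (D.trace_xi₃ n h1 h2 i (by omega))
  refine ⟨fun _ => D.pEta, false, fun _ => D.pEta_init, D.pEta, D.pEta_init, fun _ _ => rfl,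
    D.pXi n, D.pXi_init n h1 h2, ?_, ℓ, Nat.zero_le _, ?_, ?_⟩
  · intro j hj
    obtain rfl : j = 0 := by omega
    simp [(D.pXi_init n h1 h2).1, D.pEta_init.1]
  · simp only [HCTLs.satT, HCTLs.always, HCTLs.equ, Function.update_self, ne_eq,
      Bool.false_eq_true, not_false_eq_true, Function.update_of_ne]
    refine ⟨⟨before ℓ le_rfl, differ⟩, ?_⟩
    rintro ⟨j, hj, hne, -⟩
    have := after j hj
    tauto
  · intro k _ hk
    simpa [HCTLs.satT] using before k hk.le
end

section
/- For every n>1, and for K_n as in the defining conditions with M_n obtained from K_n by changing the label of the node π(ξ_n)(ℓ_n+1+n) from {p} to ∅, the structure M_n does NOT satisfy the HyperLTL sentence φ_p := ∃x.∃y.( p[x] U ( (p[x]∧¬p[y]) ∧ XG(p[x]↔p[y]) ) ). -/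
theorem TreeKripke.TInit.length_eq {AP : Type} {T : TreeKripke AP} {pa : ℕ → List ℕ}
    (h : T.TInit pa) (i : ℕ) : (pa i).length = i := by
  induction i with
  | zero => simp [h.1]
  | succ i ih =>
    obtain ⟨a, ha⟩ := T.edge_child (h.2 i)
    simp [ha, ih]

theorem TreeKripke.TInit.take_one {AP : Type} {T : TreeKripke AP} {pa : ℕ → List ℕ}
    (h : T.TInit pa) (i : ℕ) : (pa (i + 1)).take 1 = pa 1 := by
  induction i with
  | zero => exact List.take_of_length_le (h.length_eq 1).le
  | succ i ih =>
    obtain ⟨a, ha⟩ := T.edge_child (h.2 (i + 1))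
    rw [ha, List.take_append_of_le_length (by rw [h.length_eq]; omega), ih]

/-- A path visiting a child of the root visits it at position one. -/
theorem TreeKripke.TInit.eq_at_one {AP : Type} {T : TreeKripke AP} {pa : ℕ → List ℕ}
    (h : T.TInit pa) {τ : List ℕ} (hτ : T.edge [] τ) (hv : ∃ i, pa i = τ) : pa 1 = τ := by
  obtain ⟨i, rfl⟩ := hv
  obtain ⟨a, ha⟩ := T.edge_child hτ
  have hi := h.length_eq i
  rw [ha] at hi
  simp at hi
  rw [← hi]

/-- The number of positions labelled `∅` that follow the word `w k` on a path of `M`, where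
index `0` stands for the path through `eta`. -/
def gapLength (n k : ℕ) : ℕ := if k = 0 then n else if k = n then n + 1 else 2 * n - k

namespace HyperKnData

variable {n ℓ : ℕ} {T M : TreeKripke Unit}

theorem pXi_one (D : HyperKnData n T ℓ) {k : ℕ} (h1 : 1 ≤ k) (h2 : k ≤ 2 * n) :
    D.pXi k 1 = D.xi k :=
  (D.pXi_init k h1 h2).eq_at_one (D.edge_xi k h1 h2) (D.pXi_visits k h1 h2)

theorem pEta_one (D : HyperKnData n T ℓ) : D.pEta 1 = D.eta :=
  D.pEta_init.eq_at_one D.edge_eta D.pEta_visits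

theorem pEta_ne (D : HyperKnData n T ℓ) (hn : 1 < n) (i : ℕ) :
    D.pEta i ≠ D.pXi n (ℓ + 1 + n) := by
  intro h
  have hX := D.pXi_init n (by omega) (by omega)
  have hi : i = ℓ + n + 1 := by
    have := congrArg List.length h
    rw [D.pEta_init.length_eq, hX.length_eq] at this
    omega
  have h1 := D.pEta_init.take_one (ℓ + n)
  rw [← hi, h, show ℓ + 1 + n = ℓ + n + 1 by omega, hX.take_one, D.pEta_one,
    D.pXi_one (by omega) (by omega)] at h1
  exact D.eta_ne_xi n (by omega) (by omega) h1.symm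

theorem pXi_eq_iff (D : HyperKnData n T ℓ) (hn : 1 < n) {k : ℕ} (h1 : 1 ≤ k)
    (h2 : k ≤ 2 * n) (i : ℕ) :
    D.pXi k i = D.pXi n (ℓ + 1 + n) ↔ k = n ∧ i = ℓ + 1 + n := by
  refine ⟨fun h => ?_, by rintro ⟨rfl, rfl⟩; rfl⟩
  have hX := D.pXi_init n (by omega) (by omega)
  have hK := D.pXi_init k h1 h2
  have hi : i = ℓ + n + 1 := by
    have := congrArg List.length h
    rw [hK.length_eq, hX.length_eq] at this
    omega
  have h3 := hK.take_one (ℓ + n)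
  rw [← hi, h, show ℓ + 1 + n = ℓ + n + 1 by omega, hX.take_one, D.pXi_one h1 h2,
    D.pXi_one (by omega) (by omega)] at h3
  exact ⟨(D.xi_inj n k (by omega) (by omega) h1 h2 h3).symm, by omega⟩

/-- Every initial path of `M` is labelled `{p}·w_k·∅^(gapLength n k)·{p}^ω` for some `k`. -/
theorem exists_trace (D : HyperKnData n T ℓ) (hn : 1 < n) (hM : MObtainedHyper M D)
    {pa : ℕ → List ℕ} (h : M.TInit pa) :
    ∃ k ≤ 2 * n, () ∈ M.V (pa 0) ∧
      (∀ i, 1 ≤ i → i ≤ ℓ → (() ∈ M.V (pa i) ↔ (D.w k).getD (i - 1) false = true)) ∧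
      ∀ i, ℓ + 1 ≤ i → (() ∈ M.V (pa i) ↔ ℓ + gapLength n k < i) := by
  obtain ⟨-, hE, hV⟩ := hM
  have hT : T.TInit pa := ⟨h.1, fun i => hE ▸ h.2 i⟩
  have h01 : T.edge [] (pa 1) := hT.1 ▸ hT.2 0
  rcases D.succ_only _ h01 with h1 | ⟨k, hk1, hk2, h1⟩
  · obtain rfl := D.pEta_unique pa hT ⟨1, h1⟩
    have hV' : ∀ i, M.V (D.pEta i) = T.V (D.pEta i) := fun i => by
      rw [hV, if_neg (D.pEta_ne hn i)]
    refine ⟨0, by omega, ?_, ?_, ?_⟩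
    · rw [hV']; exact D.trace_eta₀
    · intro i; rw [hV']; exact D.trace_eta₁ i
    · intro i hi
      rw [hV', gapLength, if_pos rfl]
      by_cases hc : ℓ + n < i
      · exact iff_of_true (D.trace_eta₃ i (by omega)) hc
      · exact iff_of_false (D.trace_eta₂ i hi (by omega)) hc
  · obtain rfl := D.pXi_unique k hk1 hk2 pa hT ⟨1, h1⟩
    have hV' : ∀ i, () ∈ M.V (D.pXi k i) ↔
        ¬ (k = n ∧ i = ℓ + 1 + n) ∧ () ∈ T.V (D.pXi k i) := fun i => by
      rw [hV]
      simp only [D.pXi_eq_iff hn hk1 hk2]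
      split_ifs with hc <;> simp [hc]
    refine ⟨k, hk2, ?_, ?_, ?_⟩
    · rw [hV']; exact ⟨by omega, D.trace_xi₀ k hk1 hk2⟩
    · intro i hi1 hi2
      rw [hV', ← D.trace_xi₁ k hk1 hk2 i hi1 hi2]
      exact and_iff_right (by omega)
    · intro i hi
      have h2 := D.trace_xi₂ k hk1 hk2 i hi
      have h3 := D.trace_xi₃ k hk1 hk2 i
      have hT' : () ∈ T.V (D.pXi k i) ↔ ℓ + (2 * n - k) < i := by
        by_cases hc : ℓ + (2 * n - k) < i
        · exact iff_of_true (h3 hc) hc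
        · exact iff_of_false (h2 (by omega)) hc
      rw [hV', hT', gapLength, if_neg (by omega)]
      split_ifs <;> omega

theorem eq_zero_of_forall_getD (D : HyperKnData n T ℓ) {k : ℕ} (hk : k ≤ 2 * n)
    (h : ∀ i, 1 ≤ i → i ≤ ℓ → (D.w k).getD (i - 1) false = true) : k = 0 := by
  by_contra hk0
  refine D.w_distinct k 0 hk (by omega) hk0 ?_
  rw [D.w0_all, List.eq_replicate_iff]
  refine ⟨D.w_len k hk, fun b hb => ?_⟩
  obtain ⟨i, hi, rfl⟩ := List.getElem_of_mem hb
  have := h (i + 1) (by omega) (by have := D.w_len k hk; omega)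
  rwa [Nat.add_sub_cancel, List.getD_eq_getElem _ _ hi] at this

end HyperKnData

theorem eq_or_of_gapLength_eq {n k k' : ℕ} (hn : 1 < n) (hk : k ≤ 2 * n) (hk' : k' ≤ 2 * n)
    (h : gapLength n k = gapLength n k') :
    k = k' ∨ (k = n ∧ k' = n - 1) ∨ (k = n - 1 ∧ k' = n) := by
  unfold gapLength at h
  split_ifs at h <;> omega

/-- The semantics of `phiP`, unfolded. -/
theorem exists_of_modelsT_phiP {M : TreeKripke Unit} (h : HCTLs.modelsT M phiP) :
    ∃ x y : ℕ → List ℕ, M.TInit x ∧ M.TInit y ∧ ∃ j, () ∈ M.V (x j) ∧ () ∉ M.V (y j) ∧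
      (∀ i, j < i → (() ∈ M.V (x i) ↔ () ∈ M.V (y i))) ∧ ∀ i < j, () ∈ M.V (x i) := by
  obtain ⟨A, v, -, x, hx, -, y, hy, -, j, -, ⟨⟨hxj, hyj⟩, hG⟩, hU⟩ := h
  simp only [HCTLs.satT, HCTLs.always, HCTLs.equ, Function.update_self, ne_eq,
    Bool.false_eq_true, not_false_eq_true, Function.update_of_ne] at hxj hyj hG hU
  refine ⟨x, y, hx, hy, j, hxj, hyj, fun i hi => ?_, fun i hi => hU i (Nat.zero_le i) hi⟩
  by_contra hc
  exact hG ⟨i, hi, by tauto, fun _ _ _ => trivial⟩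

/-- **`M_n` does not satisfy `φ_p`**: for every `n > 1`, for `K_n` satisfying the
defining conditions and `M_n` obtained from `K_n` by changing the label of
`π(ξ_n)(ℓ_n+1+n)` from `{p}` to `∅`, `M_n` does not satisfy the HyperLTL sentence
`φ_p := ∃x.∃y.( p[x] U ( (p[x] ∧ ¬p[y]) ∧ X G (p[x] ↔ p[y]) ) )`. -/
theorem Mn_not_satisfies_phiP :
    ∀ n : ℕ, 1 < n → ∀ T : TreeKripke Unit, IsRegularTree T →
      ∀ ℓ : ℕ, 1 < ℓ → ∀ D : HyperKnData n T ℓ,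
        ∀ M : TreeKripke Unit, MObtainedHyper M D →
          ¬ HCTLs.modelsT M phiP := by
  intro n hn T _ ℓ hℓ D M hM hsat
  obtain ⟨x, y, hx, hy, j, hxj, hyj, hG, hU⟩ := exists_of_modelsT_phiP hsat
  obtain ⟨k, hk, -, hxw, hxg⟩ := D.exists_trace hn hM hx
  obtain ⟨k', hk', hy0, hyw, hyg⟩ := D.exists_trace hn hM hy
  have hxall : ∀ i ≤ j, () ∈ M.V (x i) := fun i hi =>
    hi.lt_or_eq.elim (hU i) fun e => e ▸ hxj
  have hj0 : 1 ≤ j := by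
    by_contra hc
    obtain rfl : j = 0 := by omega
    exact hyj hy0
  have hzero : ℓ ≤ j → k = 0 := fun hj => D.eq_zero_of_forall_getD hk fun i h1 h2 =>
    (hxw i h1 h2).1 (hxall i (by omega))
  have hjℓ : j ≤ ℓ := by
    by_contra hc
    have := (hxg (ℓ + 1) le_rfl).1 (hxall _ (by omega))
    rw [hzero (by omega), gapLength, if_pos rfl] at this
    omega
  have hgap : gapLength n k = gapLength n k' := by
    have key : ∀ i, ℓ + 1 ≤ i → (ℓ + gapLength n k < i ↔ ℓ + gapLength n k' < i) :=
      fun i hi => by rw [← hxg i hi, ← hyg i hi]; exact hG i (by omega)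
    have h1 := key (ℓ + gapLength n k + 1) (by omega)
    have h2 := key (ℓ + gapLength n k' + 1) (by omega)
    omega
  have hcases := eq_or_of_gapLength_eq hn hk hk' hgap
  by_cases hkk : k = k'
  · subst hkk
    exact hyj ((hyw j hj0 hjℓ).2 ((hxw j hj0 hjℓ).1 hxj))
  · have hlt : j < ℓ := by
      by_contra hc
      have := hzero (by omega)
      omega
    have hlast := hG ℓ hlt
    rw [hxw ℓ (by omega) le_rfl, hyw ℓ (by omega) le_rfl] at hlast
    have hwn := D.wn_last
    have hwn1 := D.wn1_last
    rcases hcases with h | ⟨rfl, rfl⟩ | ⟨rfl, rfl⟩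
    · exact hkk h
    · rw [hwn, hwn1] at hlast
      simp at hlast
    · rw [hwn, hwn1] at hlast
      simp at hlast
end

section
/- For every n>1, for K_n and M_n as in the defining conditions (Hyper section), for every balanced KCTL* sentence ψ with |ψ|<n, and for every observation map Obs: (K_n,Obs) ⊨ ψ if and only if (M_n,Obs) ⊨ ψ. -/
/-- Satisfaction of KCTL* over a tree structure `(T, Obs)` (paths are given as raw
sequences of nodes). -/
def KCTLs.satT {AP Agt : Type} (T : TreeKripke AP) (Obs : Agt → Set AP) :
    KCTLs AP Agt → (ℕ → List ℕ) → ℕ → Prop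
  | .tt, _, _ => True
  | .atom p, pa, i => p ∈ T.V (pa i)
  | .neg φ, pa, i => ¬ KCTLs.satT T Obs φ pa i
  | .disj φ ψ, pa, i => KCTLs.satT T Obs φ pa i ∨ KCTLs.satT T Obs ψ pa i
  | .next φ, pa, i => KCTLs.satT T Obs φ pa (i + 1)
  | .untl φ ψ, pa, i => ∃ j, i ≤ j ∧ KCTLs.satT T Obs ψ pa j ∧
      ∀ k, i ≤ k → k < j → KCTLs.satT T Obs φ pa k
  | .ex φ, pa, i => ∃ pa', T.TInit pa' ∧ (∀ j, j ≤ i → pa' j = pa j) ∧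
      KCTLs.satT T Obs φ pa' i
  | .know a φ, pa, i => ∀ pa', T.TInit pa' →
      (∀ j, j ≤ i → ∀ q ∈ Obs a, (q ∈ T.V (pa j) ↔ q ∈ T.V (pa' j))) →
      KCTLs.satT T Obs φ pa' i

/-- `(T, Obs) ⊨ φ` for a tree structure `T`. -/
def KCTLs.modelsT {AP Agt : Type} (T : TreeKripke AP) (Obs : Agt → Set AP)
    (φ : KCTLs AP Agt) : Prop :=
  ∃ pa, T.TInit pa ∧ KCTLs.satT T Obs φ pa 0
namespace KCTLs

variable {Agt : Type}

/-- Satisfaction over a family of traces `lab` (one per path), where distinct paths share only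
the root and an agent either sees `()` or is blind. -/
def satFamily {ι : Type} (lab : ι → ℕ → Prop) (Obs : Agt → Set Unit) :
    KCTLs Unit Agt → ι → ℕ → Prop
  | .tt, _, _ => True
  | .atom _, k, i => lab k i
  | .neg φ, k, i => ¬ satFamily lab Obs φ k i
  | .disj φ ψ, k, i => satFamily lab Obs φ k i ∨ satFamily lab Obs ψ k i
  | .next φ, k, i => satFamily lab Obs φ k (i + 1)
  | .untl φ ψ, k, i => ∃ j, i ≤ j ∧ satFamily lab Obs ψ k j ∧
      ∀ m, i ≤ m → m < j → satFamily lab Obs φ k m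
  | .ex φ, k, i => ∃ k', (i = 0 ∨ k' = k) ∧ satFamily lab Obs φ k' i
  | .know a φ, k, i => ∀ k', (∀ j, j ≤ i → () ∈ Obs a → (lab k j ↔ lab k' j)) →
      satFamily lab Obs φ k' i

/-- Satisfaction in the configuration where the current path still carries `d` empty labels
and, over all paths, this number takes exactly the values `0, …, N`. -/
def satCounter (Obs : Agt → Set Unit) : KCTLs Unit Agt → ℕ → ℕ → Prop
  | .tt, _, _ => True
  | .atom _, d, _ => d = 0
  | .neg φ, d, N => ¬ satCounter Obs φ d N
  | .disj φ ψ, d, N => satCounter Obs φ d N ∨ satCounter Obs ψ d N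
  | .next φ, d, N => satCounter Obs φ (d - 1) (N - 1)
  | .untl φ ψ, d, N => ∃ j, satCounter Obs ψ (d - j) (N - j) ∧
      ∀ m, m < j → satCounter Obs φ (d - m) (N - m)
  | .ex φ, d, N => satCounter Obs φ d N
  | .know a φ, d, N => (() ∈ Obs a → satCounter Obs φ d N) ∧
      (() ∉ Obs a → ∀ d', d' ≤ N → satCounter Obs φ d' N)

theorem one_le_size {AP : Type} (φ : KCTLs AP Agt) : 1 ≤ φ.size := by
  cases φ <;> simp [size]

theorem satCounter_untl_iff (Obs : Agt → Set Unit) (φ ψ : KCTLs Unit Agt) (d N : ℕ) :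
    satCounter Obs (.untl φ ψ) d N ↔ satCounter Obs ψ d N ∨
      (satCounter Obs φ d N ∧ satCounter Obs (.untl φ ψ) (d - 1) (N - 1)) := by
  simp only [satCounter]
  constructor
  · rintro ⟨j, hj, h⟩
    rcases j with _ | j
    · exact Or.inl (by simpa using hj)
    · refine Or.inr ⟨by simpa using h 0 (by omega), j, ?_, fun m hm => ?_⟩
      · simpa [Nat.sub_sub, Nat.add_comm] using hj
      · simpa [Nat.sub_sub, Nat.add_comm] using h (m + 1) (by omega)
  · rintro (h | ⟨h0, j, hj, h⟩)
    · exact ⟨0, by simpa using h, by simp⟩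
    · refine ⟨j + 1, by simpa [Nat.sub_sub, Nat.add_comm] using hj, fun m hm => ?_⟩
      rcases m with _ | m
      · simpa using h0
      · simpa [Nat.sub_sub, Nat.add_comm] using h m (by omega)

/-- The configurations `(d, N)` and `(d', N')` agree up to the thresholds relevant for
balanced formulas of size `s`. -/
def CounterEquiv (s d N d' N' : ℕ) : Prop :=
  d ≤ N ∧ d' ≤ N' ∧ (d = d' ∨ s ≤ d ∧ s ≤ d') ∧
    (N - d = N' - d' ∨ s - 1 ≤ N - d ∧ s - 1 ≤ N' - d') ∧
    (N = N' ∨ 2 * s - 2 ≤ N ∧ 2 * s - 2 ≤ N')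

theorem satCounter_untl_congr (Obs : Agt → Set Unit) {φ ψ : KCTLs Unit Agt} {s : ℕ}
    (hφ : ∀ d N d' N', CounterEquiv s d N d' N' →
      (satCounter Obs φ d N ↔ satCounter Obs φ d' N'))
    (hψ : ∀ d N d' N', CounterEquiv s d N d' N' →
      (satCounter Obs ψ d N ↔ satCounter Obs ψ d' N'))
    {d N d' N' : ℕ} (h : CounterEquiv (s + s + 1) d N d' N') :
    satCounter Obs (.untl φ ψ) d N ↔ satCounter Obs (.untl φ ψ) d' N' := by
  set U := satCounter Obs (.untl φ ψ)
  have unroll : ∀ d N, U d N ↔ satCounter Obs ψ d N ∨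
      (satCounter Obs φ d N ∧ U (d - 1) (N - 1)) := satCounter_untl_iff Obs φ ψ
  have stepD : ∀ e d, 2 * s ≤ d → (U (d + 1) (d + 1 + e) ↔ U d (d + e)) := by
    intro e d hd
    have hR : CounterEquiv s (d + 1) (d + 1 + e) d (d + e) := by
      unfold CounterEquiv; omega
    have h1 := unroll (d + 1) (d + 1 + e)
    have h2 := unroll d (d + e)
    rw [hφ _ _ _ _ hR, hψ _ _ _ _ hR, show d + 1 + e - 1 = d + e by omega,
      Nat.add_sub_cancel] at h1
    tauto
  have stepE : ∀ e, 2 * s ≤ e → ∀ d, (U d (d + (e + 1)) ↔ U d (d + e)) := by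
    intro e he d
    have hR : ∀ d, CounterEquiv s d (d + (e + 1)) d (d + e) := by
      intro d; unfold CounterEquiv; omega
    induction d with
    | zero =>
      have h1 := unroll 0 (0 + (e + 1))
      have h2 := unroll 0 (0 + e)
      rw [hφ _ _ _ _ (hR 0), hψ _ _ _ _ (hR 0), show 0 + (e + 1) - 1 = 0 + e by omega] at h1
      simp only [Nat.zero_sub] at h1
      tauto
    | succ d ih =>
      rw [unroll, unroll (d + 1) (d + 1 + e), hφ _ _ _ _ (hR _), hψ _ _ _ _ (hR _),
        show d + 1 + (e + 1) - 1 = d + (e + 1) by omega,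
        show d + 1 + e - 1 = d + e by omega, Nat.add_sub_cancel, propext ih]
  have farD : ∀ e d, 2 * s ≤ d → (U d (d + e) ↔ U (2 * s) (2 * s + e)) := by
    intro e d hd
    induction d, hd using Nat.le_induction with
    | base => rfl
    | succ d hd ih => rw [stepD e d hd, ih]
  have farE : ∀ d e, 2 * s ≤ e → (U d (d + e) ↔ U d (d + 2 * s)) := by
    intro d e he
    induction e, he using Nat.le_induction with
    | base => rfl
    | succ e he ih => rw [stepE e he d, ih]
  obtain ⟨h1, h2, hd, he, -⟩ := h
  obtain ⟨e, rfl⟩ := Nat.exists_eq_add_of_le h1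
  obtain ⟨e', rfl⟩ := Nat.exists_eq_add_of_le h2
  simp only [Nat.add_sub_cancel_left] at he
  have hE : ∀ x, U x (x + e) ↔ U x (x + e') := by
    intro x
    rcases he with rfl | he
    · rfl
    · rw [farE x e (by omega), farE x e' (by omega)]
  rw [hE d]
  rcases hd with rfl | hd
  · rfl
  · rw [farD e' d (by omega), farD e' d' (by omega)]

theorem satCounter_congr (Obs : Agt → Set Unit) (φ : KCTLs Unit Agt) (hb : φ.balanced) :
    ∀ d N d' N', CounterEquiv φ.size d N d' N' →
      (satCounter Obs φ d N ↔ satCounter Obs φ d' N') := by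
  induction φ with
  | tt => intros; rfl
  | atom p =>
    rintro d N d' N' h
    simp only [satCounter]
    simp only [size, CounterEquiv] at h
    omega
  | neg φ ih =>
    intro d N d' N' h
    simp only [satCounter]
    rw [ih hb d N d' N']
    simp only [size, CounterEquiv] at h ⊢
    omega
  | disj φ ψ ih1 ih2 =>
    intro d N d' N' h
    simp only [satCounter]
    simp only [size, CounterEquiv] at h
    rw [ih1 hb.1 d N d' N' (by unfold CounterEquiv; omega),
      ih2 hb.2 d N d' N' (by unfold CounterEquiv; omega)]
  | next φ ih =>
    intro d N d' N' h
    simp only [satCounter]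
    apply ih hb
    have := one_le_size φ
    simp only [size, CounterEquiv] at h ⊢
    omega
  | untl φ ψ ih1 ih2 =>
    intro d N d' N' h
    obtain ⟨hs, hb1, hb2⟩ := hb
    simp only [size, ← hs] at h
    exact satCounter_untl_congr Obs (ih1 hb1) (hs ▸ ih2 hb2) h
  | ex φ ih =>
    intro d N d' N' h
    simp only [satCounter]
    apply ih hb
    simp only [size, CounterEquiv] at h ⊢
    omega
  | know a φ ih =>
    intro d N d' N' h
    have hsize := one_le_size φ
    simp only [size, CounterEquiv] at h
    have blind : ∀ M M', (M = M' ∨ 2 * φ.size ≤ M ∧ 2 * φ.size ≤ M') →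
        (∀ x, x ≤ M → satCounter Obs φ x M) → ∀ x, x ≤ M' → satCounter Obs φ x M' := by
      intro M M' hM H x hx
      obtain ⟨y, hy, hR⟩ : ∃ y, y ≤ M ∧ CounterEquiv φ.size y M x M' := by
        rcases hM with rfl | hM
        · exact ⟨x, hx, by unfold CounterEquiv; omega⟩
        · by_cases h1 : x < φ.size
          · exact ⟨x, by omega, by unfold CounterEquiv; omega⟩
          · by_cases h2 : M' - x < φ.size - 1
            · exact ⟨M - (M' - x), by omega, by unfold CounterEquiv; omega⟩
            · exact ⟨φ.size, by omega, by unfold CounterEquiv; omega⟩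
      exact (ih hb _ _ _ _ hR).1 (H y hy)
    simp only [satCounter]
    rw [ih hb d N d' N' (by unfold CounterEquiv; omega)]
    have hN : (∀ x, x ≤ N → satCounter Obs φ x N) ↔ ∀ x, x ≤ N' → satCounter Obs φ x N' :=
      ⟨blind N N' (by omega), blind N' N (by omega)⟩
    rw [hN]

theorem satFamily_iff_satCounter {ι : Type} {lab : ι → ℕ → Prop} (Obs : Agt → Set Unit)
    {b B : ℕ} {off : ι → ℕ} (hb : 0 < b)
    (hlab : ∀ k t, lab k (b + t) ↔ off k ≤ t)
    (hsep : ∀ k k', (∀ j, j < b → (lab k j ↔ lab k' j)) → k = k')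
    (hle : ∀ k, off k ≤ B) (hsurj : ∀ d, d ≤ B → ∃ k, off k = d)
    (φ : KCTLs Unit Agt) :
    ∀ k t, satFamily lab Obs φ k (b + t) ↔ satCounter Obs φ (off k - t) (B - t) := by
  induction φ with
  | tt => intros; rfl
  | atom p =>
    intro k t
    simp only [satFamily, satCounter, hlab]
    omega
  | neg φ ih => intro k t; simp only [satFamily, satCounter, ih]
  | disj φ ψ ih1 ih2 => intro k t; simp only [satFamily, satCounter, ih1, ih2]
  | next φ ih =>
    intro k t
    simp only [satFamily, satCounter, Nat.sub_sub]
    exact ih k (t + 1)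
  | untl φ ψ ih1 ih2 =>
    intro k t
    simp only [satFamily, satCounter, Nat.sub_sub]
    constructor
    · rintro ⟨j, hj, h1, h2⟩
      obtain ⟨m, rfl⟩ := Nat.exists_eq_add_of_le hj
      rw [Nat.add_assoc, ih2] at h1
      refine ⟨m, h1, fun x hx => ?_⟩
      rw [← ih1, ← Nat.add_assoc]
      exact h2 _ (by omega) (by omega)
    · rintro ⟨m, h1, h2⟩
      refine ⟨b + t + m, by omega, by rwa [Nat.add_assoc, ih2], fun x hx hxm => ?_⟩
      obtain ⟨y, rfl⟩ := Nat.exists_eq_add_of_le hx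
      rw [Nat.add_assoc, ih1]
      exact h2 y (by omega)
  | ex φ ih =>
    intro k t
    simp only [satFamily, satCounter, ← ih]
    constructor
    · rintro ⟨k', h | rfl, h'⟩
      · omega
      · exact h'
    · exact fun h => ⟨k, Or.inr rfl, h⟩
  | know a φ ih =>
    intro k t
    simp only [satFamily, satCounter]
    by_cases ha : () ∈ Obs a
    · simp only [ha, not_true_eq_false, false_implies, and_true, true_implies, ← ih]
      refine ⟨fun h => h k fun _ _ => Iff.rfl, fun h k' hk' => ?_⟩
      obtain rfl := hsep k k' fun j hj => hk' j (by omega)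
      exact h
    · simp only [ha, not_false_eq_true, false_implies, true_and, true_implies, implies_true, ih]
      constructor
      · intro h d' hd'
        rcases Nat.eq_zero_or_pos d' with rfl | hpos
        · obtain ⟨k', hk'⟩ := hsurj 0 (by omega)
          simpa [hk'] using h k'
        · obtain ⟨k', hk'⟩ := hsurj (d' + t) (by omega)
          simpa [hk'] using h k'
      · exact fun h k' => h _ (Nat.sub_le_sub_right (hle k') t)

/-- Two families of traces which agree before time `b`, and from then on satisfy the same small
formulas, satisfy the same small formulas up to time `b`. -/
theorem satFamily_congr {ι : Type} {lab lab' : ι → ℕ → Prop} (Obs : Agt → Set Unit)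
    {b s : ℕ} (hlab : ∀ k j, j < b → (lab k j ↔ lab' k j))
    (hbase : ∀ φ : KCTLs Unit Agt, φ.balanced → φ.size ≤ s → ∀ k,
      (satFamily lab Obs φ k b ↔ satFamily lab' Obs φ k b))
    (φ : KCTLs Unit Agt) (hφ : φ.balanced) (hs : φ.size ≤ s) :
    ∀ k i, i ≤ b → (satFamily lab Obs φ k i ↔ satFamily lab' Obs φ k i) := by
  have untl_iff : ∀ (lab : ι → ℕ → Prop) (φ ψ : KCTLs Unit Agt) k i,
      satFamily lab Obs (.untl φ ψ) k i ↔ satFamily lab Obs ψ k i ∨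
        (satFamily lab Obs φ k i ∧ satFamily lab Obs (.untl φ ψ) k (i + 1)) := by
    intro lab φ ψ k i
    simp only [satFamily]
    constructor
    · rintro ⟨j, hij, hj, h⟩
      rcases hij.eq_or_lt with rfl | hlt
      · exact Or.inl hj
      · exact Or.inr ⟨h i le_rfl hlt, j, hlt, hj, fun m hm => h m (by omega)⟩
    · rintro (h | ⟨h0, j, hij, hj, h⟩)
      · exact ⟨i, le_rfl, h, fun m _ _ => by omega⟩
      · refine ⟨j, by omega, hj, fun m hm hmj => ?_⟩
        rcases hm.eq_or_lt with rfl | hlt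
        · exact h0
        · exact h m hlt hmj
  induction φ with
  | tt => intros; rfl
  | atom p =>
    intro k i hi
    rcases hi.eq_or_lt with rfl | hlt
    · exact hbase _ hφ hs k
    · exact hlab k i hlt
  | neg φ ih =>
    intro k i hi
    simp only [size] at hs
    simp only [satFamily, ih hφ (by omega) k i hi]
  | disj φ ψ ih1 ih2 =>
    intro k i hi
    simp only [size] at hs
    simp only [satFamily, ih1 hφ.1 (by omega) k i hi, ih2 hφ.2 (by omega) k i hi]
  | next φ ih =>
    intro k i hi
    rcases hi.eq_or_lt with rfl | hlt
    · exact hbase _ hφ hs k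
    · simp only [size] at hs
      exact ih hφ (by omega) k (i + 1) hlt
  | untl φ ψ ih1 ih2 =>
    intro k i hi
    induction hi using Nat.decreasingInduction with
    | self => exact hbase _ hφ hs k
    | of_succ i hi ih =>
      simp only [size] at hs
      rw [untl_iff lab, untl_iff lab', ih, ih1 hφ.2.1 (by omega) k i hi.le,
        ih2 hφ.2.2 (by omega) k i hi.le]
  | ex φ ih =>
    intro k i hi
    simp only [size] at hs
    simp only [satFamily, ih hφ (by omega) _ i hi]
  | know a φ ih =>
    intro k i hi
    rcases hi.eq_or_lt with rfl | hlt
    · exact hbase _ hφ hs k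
    · simp only [size] at hs
      simp only [satFamily, ih hφ (by omega) _ i hi]
      refine forall_congr' fun k' => imp_congr_left (forall₂_congr fun j hj => ?_)
      rw [hlab k j (by omega), hlab k' j (by omega)]

theorem satT_iff_satFamily {ι : Type} {T : TreeKripke Unit} (Obs : Agt → Set Unit)
    {P : ι → ℕ → List ℕ} (hP : ∀ pa, T.TInit pa ↔ ∃ k, pa = P k)
    (hfork : ∀ k k', P k 1 = P k' 1 → k = k') (φ : KCTLs Unit Agt) :
    ∀ k i, satT T Obs φ (P k) i ↔ satFamily (fun k i => () ∈ T.V (P k i)) Obs φ k i := by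
  have hroot : ∀ k, P k 0 = [] := fun k => ((hP _).2 ⟨k, rfl⟩).1
  induction φ with
  | tt => intros; rfl
  | atom p => intros; rfl
  | neg φ ih => intro k i; simp only [satT, satFamily, ih]
  | disj φ ψ ih1 ih2 => intro k i; simp only [satT, satFamily, ih1, ih2]
  | next φ ih => intro k i; simp only [satT, satFamily, ih]
  | untl φ ψ ih1 ih2 => intro k i; simp only [satT, satFamily, ih1, ih2]
  | ex φ ih =>
    intro k i
    simp only [satT, satFamily, hP]
    constructor
    · rintro ⟨_, ⟨k', rfl⟩, h, h'⟩
      refine ⟨k', ?_, (ih k' i).1 h'⟩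
      rcases Nat.eq_zero_or_pos i with hi | hi
      · exact Or.inl hi
      · exact Or.inr (hfork _ _ (h 1 hi))
    · rintro ⟨k', rfl | rfl, h⟩
      · refine ⟨P k', ⟨k', rfl⟩, fun j hj => ?_, (ih k' 0).2 h⟩
        rw [Nat.le_zero.1 hj, hroot, hroot]
      · exact ⟨P k', ⟨k', rfl⟩, fun _ _ => rfl, (ih k' i).2 h⟩
  | know a φ ih =>
    intro k i
    simp only [satT, satFamily, hP]
    constructor
    · exact fun h k' hk' => (ih k' i).1 (h _ ⟨k', rfl⟩ fun j hj q hq => hk' j hj hq)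
    · rintro h _ ⟨k', rfl⟩ hk'
      exact (ih k' i).2 (h k' fun j hj hq => hk' j hj () hq)

theorem modelsT_iff_satFamily {ι : Type} {T : TreeKripke Unit} (Obs : Agt → Set Unit)
    {P : ι → ℕ → List ℕ} (hP : ∀ pa, T.TInit pa ↔ ∃ k, pa = P k)
    (hfork : ∀ k k', P k 1 = P k' 1 → k = k') (φ : KCTLs Unit Agt) :
    modelsT T Obs φ ↔ ∃ k, satFamily (fun k i => () ∈ T.V (P k i)) Obs φ k 0 := by
  simp only [modelsT, hP]
  constructor
  · rintro ⟨_, ⟨k, rfl⟩, h⟩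
    exact ⟨k, (satT_iff_satFamily Obs hP hfork φ k 0).1 h⟩
  · rintro ⟨k, h⟩
    exact ⟨P k, ⟨k, rfl⟩, (satT_iff_satFamily Obs hP hfork φ k 0).2 h⟩

end KCTLs

namespace TreeKripke.TInit

variable {AP : Type} {T : TreeKripke AP} {pa : ℕ → List ℕ}

theorem length_eq_s6 (h : T.TInit pa) (i : ℕ) : (pa i).length = i := by
  induction i with
  | zero => simp [h.1]
  | succ i ih =>
    obtain ⟨x, hx⟩ := T.edge_child (h.2 i)
    simp [hx, ih]

theorem prefix_of_le (h : T.TInit pa) {i j : ℕ} (hij : i ≤ j) : pa i <+: pa j := by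
  induction j, hij using Nat.le_induction with
  | base => exact List.prefix_rfl
  | succ j _ ih =>
    obtain ⟨x, hx⟩ := T.edge_child (h.2 j)
    rw [hx]
    exact ih.trans (List.prefix_append _ _)

theorem eq_of_visits (h : T.TInit pa) {τ : List ℕ} (hτ : T.edge [] τ) {i : ℕ}
    (hi : pa i = τ) : pa 1 = τ := by
  obtain ⟨x, rfl⟩ := T.edge_child hτ
  have := h.length_eq_s6 i
  rw [hi] at this
  simp only [List.nil_append, List.length_singleton] at this
  rw [this, hi]

end TreeKripke.TInit

namespace HyperKnData

variable {n ℓ : ℕ} {T : TreeKripke Unit} (D : HyperKnData n T ℓ)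

/-- The initial paths of `K_n`: `π(η)` at index `0`, and `π(ξ_k)` at index `k`. -/
def path (k : Fin (2 * n + 1)) : ℕ → List ℕ :=
  if k.val = 0 then D.pEta else D.pXi k

theorem path_one (k : Fin (2 * n + 1)) :
    D.path k 1 = if k.val = 0 then D.eta else D.xi k := by
  unfold path
  split_ifs with h
  · obtain ⟨i, hi⟩ := D.pEta_visits
    exact D.pEta_init.eq_of_visits D.edge_eta hi
  · obtain ⟨i, hi⟩ := D.pXi_visits k (by omega) (by omega)
    exact (D.pXi_init k (by omega) (by omega)).eq_of_visits
      (D.edge_xi k (by omega) (by omega)) hi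

theorem path_fork (k k' : Fin (2 * n + 1)) (h : D.path k 1 = D.path k' 1) : k = k' := by
  rw [path_one, path_one] at h
  apply Fin.ext
  split_ifs at h with h1 h2 h2
  · omega
  · exact (D.eta_ne_xi k' (by omega) (by omega) h).elim
  · exact (D.eta_ne_xi k (by omega) (by omega) h.symm).elim
  · exact D.xi_inj k k' (by omega) (by omega) (by omega) (by omega) h

theorem tinit_path (k : Fin (2 * n + 1)) : T.TInit (D.path k) := by
  unfold path
  split_ifs with h
  · exact D.pEta_init
  · exact D.pXi_init k (by omega) (by omega)

theorem tinit_iff (pa : ℕ → List ℕ) : T.TInit pa ↔ ∃ k, pa = D.path k := by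
  constructor
  · intro h
    have hedge := h.2 0
    rw [h.1] at hedge
    rcases D.succ_only _ hedge with h1 | ⟨k, hk1, hk2, h1⟩
    · exact ⟨0, by simpa [path] using D.pEta_unique pa h ⟨1, h1⟩⟩
    · refine ⟨⟨k, by omega⟩, ?_⟩
      rw [D.pXi_unique k hk1 hk2 pa h ⟨1, h1⟩, path, if_neg (by simp only; omega)]
  · rintro ⟨k, rfl⟩
    exact D.tinit_path k

theorem path_eq_iff {k k' : Fin (2 * n + 1)} {i j : ℕ} (hj : 1 ≤ j) :
    D.path k i = D.path k' j ↔ k = k' ∧ i = j := by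
  constructor
  · intro h
    have hij : i = j := by
      rw [← (D.tinit_path k).length_eq_s6 i, h, (D.tinit_path k').length_eq_s6]
    subst hij
    refine ⟨D.path_fork _ _ ?_, rfl⟩
    have h1 := (D.tinit_path k).prefix_of_le hj
    rw [h] at h1
    have h2 := (D.tinit_path k').prefix_of_le hj
    have hlen : (D.path k 1).length = (D.path k' 1).length := by
      rw [(D.tinit_path k).length_eq_s6, (D.tinit_path k').length_eq_s6]
    exact (List.prefix_of_prefix_length_le h1 h2 hlen.le).eq_of_length hlen
  · rintro ⟨rfl, rfl⟩
    rfl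

theorem label_word (k : Fin (2 * n + 1)) {j : ℕ} (hj : j < ℓ) :
    () ∈ T.V (D.path k (j + 1)) ↔ (D.w k).getD j false = true := by
  unfold path
  split_ifs with h
  · rw [D.trace_eta₁ (j + 1) (by omega) (by omega), h, Nat.add_sub_cancel]
  · rw [D.trace_xi₁ k (by omega) (by omega) (j + 1) (by omega) (by omega), Nat.add_sub_cancel]

/-- The number of empty labels following the word `w_k` on the path with index `k`. -/
def gap (_ : HyperKnData n T ℓ) (k : Fin (2 * n + 1)) : ℕ :=
  if k.val = 0 then n else 2 * n - k

theorem label_tail (k : Fin (2 * n + 1)) (t : ℕ) :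
    () ∈ T.V (D.path k (ℓ + 1 + t)) ↔ D.gap k ≤ t := by
  unfold path gap
  split_ifs with h
  · refine ⟨fun hm => ?_, fun ht => D.trace_eta₃ _ (by omega)⟩
    by_contra hlt
    exact D.trace_eta₂ _ (by omega) (by omega) hm
  · refine ⟨fun hm => ?_, fun ht => D.trace_xi₃ k (by omega) (by omega) _ (by omega)⟩
    by_contra hlt
    exact D.trace_xi₂ k (by omega) (by omega) _ (by omega) (by omega) hm

theorem label_separates (k k' : Fin (2 * n + 1))
    (h : ∀ j, j < ℓ + 1 → (() ∈ T.V (D.path k j) ↔ () ∈ T.V (D.path k' j))) : k = k' := by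
  by_contra hne
  refine D.w_distinct k k' (by omega) (by omega) (fun h' => hne (Fin.ext h')) ?_
  have hk := D.w_len k (by omega)
  have hk' := D.w_len k' (by omega)
  refine List.ext_getElem (hk.trans hk'.symm) fun j h1 h2 => ?_
  have := h (j + 1) (by omega)
  rw [D.label_word k (by omega), D.label_word k' (by omega),
    List.getD_eq_getElem _ _ h1, List.getD_eq_getElem _ _ h2] at this
  exact Bool.eq_iff_iff.2 this

end HyperKnData

/-- **Balanced small KCTL\* sentences cannot distinguish `K_n` from `M_n`** (Hyper
section): for every `n > 1`, every balanced KCTL* sentence `ψ` with `|ψ| < n` and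
every observation map `Obs`, `(K_n, Obs) ⊨ ψ` iff `(M_n, Obs) ⊨ ψ`. -/
theorem Kn_Mn_indistinguishable_by_balanced_KCTLstar (Agt : Type) :
    ∀ n : ℕ, 1 < n → ∀ T : TreeKripke Unit, IsRegularTree T →
      ∀ ℓ : ℕ, 1 < ℓ → ∀ D : HyperKnData n T ℓ,
        ∀ M : TreeKripke Unit, MObtainedHyper M D →
          ∀ ψ : KCTLs Unit Agt, KCTLs.isSentence ψ → KCTLs.balanced ψ →
            KCTLs.size ψ < n →
            ∀ Obs : Agt → Set Unit,
              (KCTLs.modelsT T Obs ψ ↔ KCTLs.modelsT M Obs ψ) := by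
  intro n hn T _ ℓ _ D M hM ψ _ hb hs Obs
  obtain ⟨-, hedge, hV⟩ := hM
  have hTM : ∀ pa, M.TInit pa ↔ T.TInit pa := fun pa => by
    simp only [TreeKripke.TInit, hedge]
  let c : Fin (2 * n + 1) := ⟨n, by omega⟩
  have hc : D.pXi n = D.path c := by
    rw [HyperKnData.path, if_neg (by simp only [c]; omega)]
  have hMlab : ∀ k i, () ∈ M.V (D.path k i) ↔
      ¬ (k = c ∧ i = ℓ + 1 + n) ∧ () ∈ T.V (D.path k i) := by
    intro k i
    rw [hV, hc, ← D.path_eq_iff (by omega : 1 ≤ ℓ + 1 + n)]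
    split_ifs with h <;> simp [h]
  have hearly : ∀ k j, j < ℓ + 1 → (() ∈ T.V (D.path k j) ↔ () ∈ M.V (D.path k j)) := by
    intro k j hj
    rw [hMlab, and_iff_right]
    omega
  have hgap : ∀ k, D.gap k ≤ 2 * n - 1 := by
    intro k
    unfold HyperKnData.gap
    split_ifs <;> omega
  have hgapc : D.gap c = n := by
    simp only [HyperKnData.gap, c]
    split_ifs <;> omega
  have hT := fun φ : KCTLs Unit Agt => KCTLs.satFamily_iff_satCounter Obs (φ := φ)
    (lab := fun k i => () ∈ T.V (D.path k i)) (b := ℓ + 1) (B := 2 * n - 1)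
    (by omega) D.label_tail D.label_separates hgap (by
      intro d hd
      refine ⟨⟨2 * n - d, by omega⟩, ?_⟩
      simp only [HyperKnData.gap]
      split_ifs <;> omega)
  have hM := fun φ : KCTLs Unit Agt => KCTLs.satFamily_iff_satCounter Obs (φ := φ)
    (lab := fun k i => () ∈ M.V (D.path k i)) (b := ℓ + 1) (B := 2 * n - 1)
    (off := fun k => if k = c then n + 1 else D.gap k) (by omega)
    (by
      intro k t
      rw [hMlab, D.label_tail]
      split_ifs with h
      · subst h
        rw [hgapc]
        simp only [true_and]
        omega
      · simp [h])
    (fun k k' h => D.label_separates k k' fun j hj => by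
      rw [hearly k j hj, hearly k' j hj]
      exact h j hj)
    (by
      intro k
      have := hgap k
      split_ifs <;> omega)
    (by
      intro d hd
      by_cases hdn : d = n
      · exact ⟨0, by simp [HyperKnData.gap, c, Fin.ext_iff, hdn]; omega⟩
      · refine ⟨⟨2 * n - d, by omega⟩, ?_⟩
        simp only [HyperKnData.gap, c, Fin.ext_iff]
        split_ifs <;> omega)
  rw [KCTLs.modelsT_iff_satFamily Obs D.tinit_iff D.path_fork,
    KCTLs.modelsT_iff_satFamily Obs (fun pa => (hTM pa).trans (D.tinit_iff pa)) D.path_fork]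
  refine exists_congr fun k => KCTLs.satFamily_congr Obs hearly (s := n - 1) ?_ ψ hb
    (by omega) k 0 (by omega)
  intro φ hφ hsize k
  refine (hT φ k 0).trans (Iff.trans ?_ (hM φ k 0).symm)
  apply KCTLs.satCounter_congr Obs φ hφ
  have := hgap k
  simp only [KCTLs.CounterEquiv, Nat.sub_zero]
  split_ifs with h
  · rw [h, hgapc]
    omega
  · omega
end

section
/- For every n>1, for K_n as in the defining conditions (KLTL section), and for every p-blind observation map Obs: (K_n,Obs) does NOT satisfy the KLTL sentence φ_p := ∀ X F K_a ¬p. -/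
/-- An `n`-block: a word in `{p}∅^*` of length at least `n+2`. -/
def IsNBlock (n : ℕ) (b : List Bool) : Prop :=
  n + 2 ≤ b.length ∧ b = true :: List.replicate (b.length - 1) false

/-- Positionwise union of two equal-length words. -/
def join2 (a b : List Bool) : List Bool := List.zipWith (· || ·) a b

/-- `joinUpTo w k = join(w_1, …, w_k)` (for `k ≥ 1`). -/
def joinUpTo (w : ℕ → List Bool) : ℕ → List Bool
  | 0 => []
  | 1 => w 1
  | (k + 2) => join2 (joinUpTo w (k + 1)) (w (k + 2))

/-- `r` is a sequence of `n+4` `n`-blocks preceded by a nonempty word in `∅^*` of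
length at least `n+2`. -/
def BlockRefine (n : ℕ) (r : List Bool) : Prop :=
  ∃ (z : List Bool) (cs : List (List Bool)),
    r = z ++ cs.flatten ∧ z ≠ [] ∧ n + 2 ≤ z.length ∧ (∀ x ∈ z, x = false) ∧
    cs.length = n + 4 ∧ (∀ c ∈ cs, IsNBlock n c)

/-- `w'` is obtained from `j` by replacing the last symbol with `∅` and replacing
each `n`-block of `j` by a sequence of `n+4` `n`-blocks preceded by a nonempty word
in `∅^*` of length at least `n+2`. -/
def SuccRel (n : ℕ) (j w' : List Bool) : Prop :=
  ∃ (bls rs : List (List Bool)),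
    (∀ b ∈ bls, IsNBlock n b) ∧
    j = bls.flatten ++ [true] ∧
    w' = rs.flatten ++ [false] ∧
    bls.length = rs.length ∧
    ∀ pr ∈ List.zip bls rs, pr.2.length = pr.1.length ∧ BlockRefine n pr.2

/-- `⟨w_1, …, w_n⟩` satisfies the `n`-fractal requirement. -/
def FractalReq (n ℓ : ℕ) (w : ℕ → List Bool) : Prop :=
  (∀ k, 1 ≤ k → k ≤ n → (w k).length = ℓ) ∧
  (∀ k, 1 ≤ k → k ≤ n → ∃ bls : List (List Bool),
      (∀ b ∈ bls, IsNBlock n b) ∧ joinUpTo w k = bls.flatten ++ [true]) ∧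
  (∃ bls : List (List Bool),
      (∀ b ∈ bls, IsNBlock n b) ∧ joinUpTo w 1 = bls.flatten ++ [true] ∧
      bls.length = n + 4) ∧
  (∀ k, 1 ≤ k → k < n → SuccRel n (joinUpTo w k) (w (k + 1)))

/-- The defining conditions of the regular tree structure `K_n` (KLTL section),
over `AP = {p}` (modelled by `Unit`), with parameter `ℓ = ℓ_n > 1`. -/
structure KLTLKnData (n : ℕ) (T : TreeKripke Unit) (ℓ : ℕ) where
  /-- the distinguished successor `η` of the root -/
  eta : List ℕ
  /-- the successors `ξ_1, …, ξ_n` of the root -/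
  xi : ℕ → List ℕ
  /-- the words `w_0, …, w_n` of length `ℓ` -/
  w : ℕ → List Bool
  /-- the unique initial path visiting `η` -/
  pEta : ℕ → List ℕ
  /-- the unique initial paths visiting `ξ_1, …, ξ_n` -/
  pXi : ℕ → ℕ → List ℕ
  edge_eta : T.edge [] eta
  edge_xi : ∀ k, 1 ≤ k → k ≤ n → T.edge [] (xi k)
  succ_only : ∀ τ, T.edge [] τ → τ = eta ∨ ∃ k, 1 ≤ k ∧ k ≤ n ∧ τ = xi k
  eta_ne_xi : ∀ k, 1 ≤ k → k ≤ n → eta ≠ xi k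
  xi_inj : ∀ k k', 1 ≤ k → k ≤ n → 1 ≤ k' → k' ≤ n → xi k = xi k' → k = k'
  pEta_init : T.TInit pEta
  pEta_visits : ∃ i, pEta i = eta
  pEta_unique : ∀ pa, T.TInit pa → (∃ i, pa i = eta) → pa = pEta
  pXi_init : ∀ k, 1 ≤ k → k ≤ n → T.TInit (pXi k)
  pXi_visits : ∀ k, 1 ≤ k → k ≤ n → ∃ i, pXi k i = xi k
  pXi_unique : ∀ k, 1 ≤ k → k ≤ n → ∀ pa, T.TInit pa → (∃ i, pa i = xi k) → pa = pXi k
  w0_len : (w 0).length = ℓ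
  fractal : FractalReq n ℓ w
  /-- `w_0` is the dual of `join(w_1, …, w_n)` -/
  w0_dual : w 0 = (joinUpTo w n).map (fun b => !b)
  /-- the trace of `π(η)` is `∅·w_0·{p}^ω` -/
  trace_eta₀ : () ∉ T.V (pEta 0)
  trace_eta₁ : ∀ i, 1 ≤ i → i ≤ ℓ → (() ∈ T.V (pEta i) ↔ (w 0).getD (i - 1) false = true)
  trace_eta₂ : ∀ i, ℓ + 1 ≤ i → () ∈ T.V (pEta i)
  /-- the trace of `π(ξ_k)` is `∅·w_k·∅^ω` -/
  trace_xi₀ : ∀ k, 1 ≤ k → k ≤ n → () ∉ T.V (pXi k 0)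
  trace_xi₁ : ∀ k, 1 ≤ k → k ≤ n → ∀ i, 1 ≤ i → i ≤ ℓ →
      (() ∈ T.V (pXi k i) ↔ (w k).getD (i - 1) false = true)
  trace_xi₂ : ∀ k, 1 ≤ k → k ≤ n → ∀ i, ℓ + 1 ≤ i → () ∉ T.V (pXi k i)

/-- `ia = i_alert`: the third main position (in increasing order) at which `π(ξ_1)`
is labeled `{p}` in `K_n` (equivalently, at which `w_1` carries `true`). -/
def IsAlert (ℓ : ℕ) (w1 : List Bool) (ia : ℕ) : Prop :=
  1 ≤ ia ∧ ia ≤ ℓ ∧ w1.getD (ia - 1) false = true ∧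
  ((Finset.Icc 1 ℓ).filter (fun i => i < ia ∧ w1.getD (i - 1) false = true)).card = 2

/-- `M` is obtained from `K_n` by replacing the label `{p}` of `π(ξ_1)(i_alert)`
with `∅`. -/
def MObtainedKLTL {n ℓ : ℕ} {T : TreeKripke Unit} (M : TreeKripke Unit)
    (D : KLTLKnData n T ℓ) (ia : ℕ) : Prop :=
  M.nodes = T.nodes ∧ M.edge = T.edge ∧
    ∀ τ, M.V τ = if τ = D.pXi 1 ia then ∅ else T.V τ
/-- The KLTL sentence `φ_p := ∀ X F K_a ¬p`, i.e. `¬∃¬( X (⊤ U (K_a ¬p)) )`. -/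
def phiK {Agt : Type} (a : Agt) : KCTLs Unit Agt :=
  .neg (.ex (.neg (.next (.untl .tt (.know a (.neg (.atom ())))))))

/-- An observation map is `p`-blind if no agent observes `p`. -/
def pBlind {Agt : Type} (Obs : Agt → Set Unit) : Prop := ∀ a, () ∉ Obs a
theorem length_joinUpTo {w : ℕ → List Bool} {n ℓ : ℕ}
    (hw : ∀ k, 1 ≤ k → k ≤ n → (w k).length = ℓ) :
    ∀ k, 1 ≤ k → k ≤ n → (joinUpTo w k).length = ℓ
  | 0, h, _ => by omega
  | 1, h, h' => hw 1 h h'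
  | k + 2, _, h' => by
    have ih := length_joinUpTo hw (k + 1) (by omega) (by omega)
    simp [joinUpTo, join2, ih, hw (k + 2) (by omega) h']

theorem exists_of_joinUpTo_getD {w : ℕ → List Bool} {i : ℕ} :
    ∀ k, (joinUpTo w k).getD i false = true →
      ∃ j, 1 ≤ j ∧ j ≤ k ∧ (w j).getD i false = true
  | 0, h => by simp [joinUpTo] at h
  | 1, h => ⟨1, le_rfl, le_rfl, h⟩
  | k + 2, h => by
    by_cases h₁ : (w (k + 2)).getD i false = true
    · exact ⟨k + 2, by omega, le_rfl, h₁⟩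
    · obtain ⟨j, hj, hjk, hi⟩ := exists_of_joinUpTo_getD (w := w) (i := i) (k + 1) (by
        simp only [joinUpTo, join2, List.getD_eq_getElem?_getD, List.getElem?_zipWith] at h h₁ ⊢
        revert h h₁
        cases (joinUpTo w (k + 1))[i]? <;> cases (w (k + 2))[i]? <;> simp_all
        grind)
      exact ⟨j, hj, by omega, hi⟩

/-- At every non-root position, some initial path of `K_n` is labeled `{p}`. -/
theorem KLTLKnData.exists_path_mem {n ℓ : ℕ} {T : TreeKripke Unit} (D : KLTLKnData n T ℓ)
    (hn : 1 ≤ n) {i : ℕ} (hi : 1 ≤ i) : ∃ pa, T.TInit pa ∧ () ∈ T.V (pa i) := by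
  by_cases hil : i ≤ ℓ
  · by_cases h : (joinUpTo D.w n).getD (i - 1) false = true
    · obtain ⟨j, hj, hjn, hji⟩ := exists_of_joinUpTo_getD n h
      exact ⟨D.pXi j, D.pXi_init j hj hjn, (D.trace_xi₁ j hj hjn i hi hil).2 hji⟩
    · refine ⟨D.pEta, D.pEta_init, (D.trace_eta₁ i hi hil).2 ?_⟩
      have hlt : i - 1 < (joinUpTo D.w n).length := by
        rw [length_joinUpTo D.fractal.1 n hn le_rfl]
        omega
      rw [D.w0_dual]
      simpa [List.getD_eq_getElem?_getD, hlt] using h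
  · exact ⟨D.pEta, D.pEta_init, D.trace_eta₂ i (by omega)⟩

/-- **`(K_n, Obs)` does not satisfy `φ_p`** (KLTL section): for every `n > 1`, for
`K_n` satisfying the defining conditions and every `p`-blind observation map `Obs`,
`(K_n, Obs)` does not satisfy the KLTL sentence `φ_p := ∀ X F K_a ¬p`. -/
theorem Kn_not_satisfies_phiK (Agt : Type) (a : Agt) :
    ∀ n : ℕ, 1 < n → ∀ T : TreeKripke Unit, IsRegularTree T →
      ∀ ℓ : ℕ, 1 < ℓ → ∀ _ : KLTLKnData n T ℓ,
        ∀ Obs : Agt → Set Unit, pBlind Obs →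
          ¬ KCTLs.modelsT T Obs (phiK a) := by
  rintro n hn T - ℓ - D Obs hObs ⟨pa, hpa, hsat⟩
  obtain ⟨j, hj, hknow, -⟩ :=
    not_not.1 fun h => hsat ⟨pa, hpa, fun _ _ => rfl, h⟩
  obtain ⟨pa', hpa', hp⟩ := D.exists_path_mem hn.le (i := j) (by omega)
  exact hknow pa' hpa' (fun _ _ q hq => absurd hq (hObs a)) hp
end

section
/- For every n>1, for K_n as in the defining conditions (KLTL section) and M_n obtained from K_n by changing the label of π(ξ_1)(i_alert) from {p} to ∅, and for every p-blind observation map Obs: (M_n,Obs) satisfies the KLTL sentence φ_p := ∀ X F K_a ¬p. -/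
theorem getD_false_eq_true_iff (l : List Bool) (i : ℕ) :
    l.getD i false = true ↔ l[i]? = some true := by
  rw [List.getD_eq_getElem?_getD]
  cases l[i]? <;> simp

/-- In an `n`-block only the first symbol can be `{p}`. -/
theorem IsNBlock.eq_zero_of_getElem? {n i : ℕ} {b : List Bool} (hb : IsNBlock n b)
    (h : b[i]? = some true) : i = 0 := by
  rw [hb.2] at h
  cases i with
  | zero => rfl
  | succ i => simp [List.getElem?_replicate] at h

theorem BlockRefine.getElem?_zero {n : ℕ} {r : List Bool} (hr : BlockRefine n r) :
    r[0]? = some false := by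
  obtain ⟨z, cs, rfl, hz, -, hf, -⟩ := hr
  cases z with
  | nil => exact absurd rfl hz
  | cons x z => simp [hf x (by simp)]

theorem getElem?_ne_of_blockRefine {n : ℕ} : ∀ (bls rs : List (List Bool)),
    (∀ b ∈ bls, IsNBlock n b) → bls.length = rs.length →
    (∀ pr ∈ List.zip bls rs, pr.2.length = pr.1.length ∧ BlockRefine n pr.2) →
    ∀ i : ℕ, (bls.flatten ++ [true])[i]? = some true → (rs.flatten ++ [false])[i]? ≠ some true
  | [], [], _, _, _, i, _ => by cases i <;> simp
  | [], _ :: _, _, h, _, _, _ => by simp at h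
  | _ :: _, [], _, h, _, _, _ => by simp at h
  | b :: bls, r :: rs, hb, hlen, hpr, i, hi => by
    obtain ⟨hrb, href⟩ : r.length = b.length ∧ BlockRefine n r := hpr (b, r) (by simp)
    rw [List.flatten_cons, List.append_assoc] at hi ⊢
    by_cases hib : i < b.length
    · rw [List.getElem?_append_left hib] at hi
      rw [List.getElem?_append_left (by omega),
        (hb b (by simp)).eq_zero_of_getElem? hi, href.getElem?_zero]
      simp
    · rw [List.getElem?_append_right (by omega)] at hi
      rw [List.getElem?_append_right (by omega), hrb]
      exact getElem?_ne_of_blockRefine bls rs (fun c hc => hb c (List.mem_cons_of_mem _ hc))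
        (by simpa using hlen) (fun pr h => hpr pr (by simp [h])) _ hi

theorem SuccRel.getElem?_ne {n i : ℕ} {j w' : List Bool} (h : SuccRel n j w')
    (hi : j[i]? = some true) : w'[i]? ≠ some true := by
  obtain ⟨bls, rs, hb, rfl, rfl, hlen, hpr⟩ := h
  exact getElem?_ne_of_blockRefine bls rs hb hlen hpr i hi

/-- Positions marked in `w 1` stay marked in every `joinUpTo w k`. -/
theorem joinUpTo_getElem?_of_one {n ℓ i : ℕ} {w : ℕ → List Bool}
    (hlen : ∀ k, 1 ≤ k → k ≤ n → (w k).length = ℓ) (hi : (w 1)[i]? = some true) (hiℓ : i < ℓ) :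
    ∀ k, k + 1 ≤ n → (joinUpTo w (k + 1))[i]? = some true
  | 0, _ => hi
  | k + 1, hk => by
    have ih := joinUpTo_getElem?_of_one hlen hi hiℓ k (by omega)
    have hw : i < (w (k + 2)).length := by rw [hlen _ (by omega) hk]; exact hiℓ
    simp [joinUpTo, join2, List.getElem?_zipWith, ih, List.getElem?_eq_getElem hw]

/-- Every initial path of `K_n` is one of the distinguished paths. -/
theorem KLTLKnData.init_cases {n ℓ : ℕ} {T : TreeKripke Unit} (D : KLTLKnData n T ℓ)
    {pa : ℕ → List ℕ} (h : T.TInit pa) :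
    pa = D.pEta ∨ ∃ k, 1 ≤ k ∧ k ≤ n ∧ pa = D.pXi k := by
  have h1 := h.2 0
  rw [h.1] at h1
  rcases D.succ_only _ h1 with h2 | ⟨k, hk, hkn, h2⟩
  · exact Or.inl (D.pEta_unique pa h ⟨_, h2⟩)
  · exact Or.inr ⟨k, hk, hkn, D.pXi_unique k hk hkn pa h ⟨_, h2⟩⟩

/-- At the alert position no initial path of `M_n` is labeled `{p}`. -/
theorem MObtainedKLTL.not_mem_alert {n ℓ ia : ℕ} {T M : TreeKripke Unit} {D : KLTLKnData n T ℓ}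
    (hM : MObtainedKLTL M D ia) (hn : 1 ≤ n) (hia : IsAlert ℓ (D.w 1) ia)
    {pa : ℕ → List ℕ} (hpa : M.TInit pa) : () ∉ M.V (pa ia) := by
  obtain ⟨-, hedge, hV⟩ := hM
  obtain ⟨h1, h2, h3, -⟩ := hia
  rw [getD_false_eq_true_iff] at h3
  have hjoin := joinUpTo_getElem?_of_one D.fractal.1 h3 (by omega)
  rw [hV]
  split_ifs with hτ
  · simp
  have hT : T.TInit pa := ⟨hpa.1, fun i => hedge ▸ hpa.2 i⟩
  rcases D.init_cases hT with rfl | ⟨k, hk, hkn, rfl⟩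
  · have hjn := hjoin (n - 1) (by omega)
    rw [Nat.sub_add_cancel hn] at hjn
    rw [D.trace_eta₁ ia h1 h2, getD_false_eq_true_iff, D.w0_dual, List.getElem?_map, hjn]
    simp
  · rw [D.trace_xi₁ k hk hkn ia h1 h2, getD_false_eq_true_iff]
    obtain rfl | ⟨k, rfl⟩ : k = 1 ∨ ∃ m, k = m + 2 := by
      rcases Nat.lt_or_ge k 2 with h | h
      · left; omega
      · exact Or.inr ⟨k - 2, by omega⟩
    · exact absurd rfl hτ
    · exact (D.fractal.2.2.2 (k + 1) (by omega) (by omega)).getElem?_ne (hjoin k (by omega))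

/-- **`(M_n, Obs)` satisfies `φ_p`** (KLTL section): for every `n > 1`, for `K_n`
satisfying the defining conditions, `M_n` obtained from `K_n` by changing the label
of `π(ξ_1)(i_alert)` from `{p}` to `∅`, and every `p`-blind observation map `Obs`,
`(M_n, Obs)` satisfies the KLTL sentence `φ_p := ∀ X F K_a ¬p`. -/
theorem Mn_satisfies_phiK (Agt : Type) (a : Agt) :
    ∀ n : ℕ, 1 < n → ∀ T : TreeKripke Unit, IsRegularTree T →
      ∀ ℓ : ℕ, 1 < ℓ → ∀ D : KLTLKnData n T ℓ,
        ∀ ia : ℕ, IsAlert ℓ (D.w 1) ia →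
          ∀ M : TreeKripke Unit, MObtainedKLTL M D ia →
            ∀ Obs : Agt → Set Unit, pBlind Obs →
              KCTLs.modelsT M Obs (phiK a) := by
  intro n hn T _ ℓ _ D ia hia M hM Obs _
  have hinit : M.TInit D.pEta :=
    ⟨D.pEta_init.1, fun i => hM.2.1.symm ▸ D.pEta_init.2 i⟩
  refine ⟨D.pEta, hinit, ?_⟩
  rintro ⟨pa, -, -, hpa⟩
  refine hpa ⟨ia, hia.1, ?_, fun _ _ _ => trivial⟩
  exact fun pa' hpa' _ => hM.not_mem_alert hn.le hia hpa'
end
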